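/- arXiv:1805.12595 — 2 statements merged into one kernel-verified Lean document; each statement's English description precedes it below -/
import Mathlib

section
/- Let the compound primitive relay channel have a compact convex state set Q ⊆ P(S), and suppose the channel is strongly degraded. Then the deterministic code capacity, R_DF(Q), and R_CS(Q) all coincide and equal max_{p(x)} min{ min_{q∈Q} I_q(X;Y) + C_1, I(X;Y_1) }, where I(X;Y_1) is computed under p(x) and the state-independent channel W_{Y_1|X}. -/
open scoped BigOperators ENNReal

noncomputable section

/-- `p` is a probability mass function on a finite type. -/
def IsPMF {α : Type} [Fintype α] (p : α → ℝ) : Prop :=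
  (∀ a, 0 ≤ p a) ∧ ∑ a, p a = 1

/-- `W` is a channel: each `W x s` is a pmf on the output alphabet. -/
def IsChannel {𝒳 𝒮 𝒵 : Type} [Fintype 𝒵] (W : 𝒳 → 𝒮 → 𝒵 → ℝ) : Prop :=
  ∀ x s, IsPMF (W x s)

/-- Shannon entropy (base 2). By the convention `log₂ 0 = 0` in Mathlib, terms with
`p a = 0` contribute `0`. -/
def ent {α : Type} [Fintype α] (p : α → ℝ) : ℝ :=
  -∑ a, p a * Real.logb 2 (p a)

/-- Mutual information of a joint pmf on a product of finite types. -/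
def mutInfo {α β : Type} [Fintype α] [Fintype β] (p : α × β → ℝ) : ℝ :=
  ent (fun a => ∑ b, p (a, b)) + ent (fun b => ∑ a, p (a, b)) - ent p

/-- Conditional mutual information `I(X;Y|U)` of a joint pmf on `U × X × Y`,
via `I(X;Y|U) = H(U,X) + H(U,Y) − H(U,X,Y) − H(U)`. -/
def condMutInfo {υ α β : Type} [Fintype υ] [Fintype α] [Fintype β]
    (p : υ × α × β → ℝ) : ℝ :=
  ent (fun ua : υ × α => ∑ b, p (ua.1, ua.2, b))
    + ent (fun ub : υ × β => ∑ a, p (ub.1, a, ub.2))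
    - ent p
    - ent (fun u : υ => ∑ a, ∑ b, p (u, a, b))

section InfoQuantities

variable {𝒳 𝒮 𝒴 𝒴₁ : Type} [Fintype 𝒳] [Fintype 𝒮] [Fintype 𝒴] [Fintype 𝒴₁]

/-- `I_q(X;Y)` under input pmf `p(x)`, state pmf `q(s)` and channel `W`. -/
def IqXY (W : 𝒳 → 𝒮 → 𝒴 × 𝒴₁ → ℝ) (p : 𝒳 → ℝ) (q : 𝒮 → ℝ) : ℝ :=
  mutInfo (fun xy : 𝒳 × 𝒴 => p xy.1 * ∑ s, q s * ∑ y1, W xy.1 s (xy.2, y1))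

/-- `I_q(X;Y,Y₁)`. -/
def IqXYY1 (W : 𝒳 → 𝒮 → 𝒴 × 𝒴₁ → ℝ) (p : 𝒳 → ℝ) (q : 𝒮 → ℝ) : ℝ :=
  mutInfo (fun xz : 𝒳 × (𝒴 × 𝒴₁) => p xz.1 * ∑ s, q s * W xz.1 s xz.2)

/-- `I_q(U;Y)` under input pmf `p(u,x)` (auxiliary alphabet `Fin k`). -/
def IqUY {k : ℕ} (W : 𝒳 → 𝒮 → 𝒴 × 𝒴₁ → ℝ) (p : Fin k × 𝒳 → ℝ) (q : 𝒮 → ℝ) : ℝ :=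
  mutInfo (fun uy : Fin k × 𝒴 => ∑ x, ∑ s, ∑ y1, p (uy.1, x) * q s * W x s (uy.2, y1))

/-- `I_q(U;Y₁)` under input pmf `p(u,x)`. -/
def IqUY1 {k : ℕ} (W : 𝒳 → 𝒮 → 𝒴 × 𝒴₁ → ℝ) (p : Fin k × 𝒳 → ℝ) (q : 𝒮 → ℝ) : ℝ :=
  mutInfo (fun uy : Fin k × 𝒴₁ => ∑ x, ∑ s, ∑ y, p (uy.1, x) * q s * W x s (y, uy.2))

/-- `I_q(X;Y|U)` under input pmf `p(u,x)`. -/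
def IqXYgivenU {k : ℕ} (W : 𝒳 → 𝒮 → 𝒴 × 𝒴₁ → ℝ) (p : Fin k × 𝒳 → ℝ) (q : 𝒮 → ℝ) : ℝ :=
  condMutInfo (fun uxy : Fin k × 𝒳 × 𝒴 =>
    p (uxy.1, uxy.2.1) * ∑ s, q s * ∑ y1, W uxy.2.1 s (uxy.2.2, y1))

/-- The partial decode-forward lower bound `R_DF(Q)`: the supremum over all finite
auxiliary alphabets (represented by `Fin k`) and input pmfs `p(u,x)` of
`min{ inf_q I_q(U;Y) + inf_q I_q(X;Y|U) + C₁, inf_q I_q(U;Y₁) + inf_q I_q(X;Y|U) }`. -/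
def RDF (W : 𝒳 → 𝒮 → 𝒴 × 𝒴₁ → ℝ) (C1 : ℝ) (Q : Set (𝒮 → ℝ)) : ℝ :=
  sSup {r | ∃ (k : ℕ) (p : Fin k × 𝒳 → ℝ), IsPMF p ∧
    r = min
      (sInf {v | ∃ q ∈ Q, v = IqUY W p q} + sInf {v | ∃ q ∈ Q, v = IqXYgivenU W p q} + C1)
      (sInf {v | ∃ q ∈ Q, v = IqUY1 W p q} + sInf {v | ∃ q ∈ Q, v = IqXYgivenU W p q})}

/-- The cutset upper bound
`R_CS(Q) = inf_{q∈Q} max_{p(x)} min{ I_q(X;Y) + C₁, I_q(X;Y,Y₁) }`. -/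
def RCS (W : 𝒳 → 𝒮 → 𝒴 × 𝒴₁ → ℝ) (C1 : ℝ) (Q : Set (𝒮 → ℝ)) : ℝ :=
  sInf {r | ∃ q ∈ Q, r = sSup {v | ∃ p : 𝒳 → ℝ, IsPMF p ∧
    v = min (IqXY W p q + C1) (IqXYY1 W p q)}}

end InfoQuantities

/-- A deterministic code for the primitive relay channel: a message encoder, a relay
function mapping the relay's received block to one of `L` indices sent over the
noiseless link, and a decoder using the channel output together with that index. -/
structure PCode (𝒳 𝒴 𝒴₁ : Type) (n M L : ℕ) where
  f : Fin M → Fin n → 𝒳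
  f1 : (Fin n → 𝒴₁) → Fin L
  g : (Fin n → 𝒴) × Fin L → Fin M

/-- The noiseless link of rate `C₁` supports `L` indices when `L ≤ 2^{nC₁}`. -/
def LinkOK (n L : ℕ) (C1 : ℝ) : Prop := 1 ≤ L ∧ (L : ℝ) ≤ (2 : ℝ) ^ ((n : ℝ) * C1)

section Codes

variable {𝒳 𝒮 𝒴 𝒴₁ : Type} [Fintype 𝒳] [Fintype 𝒮] [Fintype 𝒴] [Fintype 𝒴₁]
variable {n M L : ℕ}

/-- Conditional probability of error of the code given the state sequence `s`. -/
def PCode.errGiven (C : PCode 𝒳 𝒴 𝒴₁ n M L) (W : 𝒳 → 𝒮 → 𝒴 × 𝒴₁ → ℝ)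
    (s : Fin n → 𝒮) : ℝ :=
  (M : ℝ)⁻¹ * ∑ m : Fin M, ∑ y : Fin n → 𝒴, ∑ y1 : Fin n → 𝒴₁,
    if C.g (y, C.f1 y1) = m then 0 else ∏ i, W (C.f m i) (s i) (y i, y1 i)

/-- Average error probability under an i.i.d. state distribution `q`. -/
def PCode.errIID (C : PCode 𝒳 𝒴 𝒴₁ n M L) (W : 𝒳 → 𝒮 → 𝒴 × 𝒴₁ → ℝ)
    (q : 𝒮 → ℝ) : ℝ :=
  ∑ s : Fin n → 𝒮, (∏ i, q (s i)) * C.errGiven W s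

/-- Average error probability under an arbitrary joint state distribution `qn`. -/
def PCode.errJoint (C : PCode 𝒳 𝒴 𝒴₁ n M L) (W : 𝒳 → 𝒮 → 𝒴 × 𝒴₁ → ℝ)
    (qn : (Fin n → 𝒮) → ℝ) : ℝ :=
  ∑ s : Fin n → 𝒮, qn s * C.errGiven W s

end Codes

section Capacities

variable {𝒳 𝒮 𝒴 𝒴₁ : Type} [Fintype 𝒳] [Fintype 𝒮] [Fintype 𝒴] [Fintype 𝒴₁]

/-- `R` is achievable by deterministic codes over the compound primitive relay
channel with state set `Q`. -/
def CompAchievable (W : 𝒳 → 𝒮 → 𝒴 × 𝒴₁ → ℝ) (C1 : ℝ) (Q : Set (𝒮 → ℝ)) (R : ℝ) : Prop :=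
  ∀ ε > (0 : ℝ), ∃ N : ℕ, ∀ n ≥ N, ∃ (M L : ℕ) (C : PCode 𝒳 𝒴 𝒴₁ n M L),
    (2 : ℝ) ^ ((n : ℝ) * R) ≤ (M : ℝ) ∧ LinkOK n L C1 ∧
    ∀ q ∈ Q, C.errIID W q ≤ ε

/-- The deterministic code capacity of the compound primitive relay channel. -/
def CompCapacity (W : 𝒳 → 𝒮 → 𝒴 × 𝒴₁ → ℝ) (C1 : ℝ) (Q : Set (𝒮 → ℝ)) : ℝ :=
  sSup {R | CompAchievable W C1 Q R}

/-- `R` is achievable by random codes over the compound primitive relay channel. -/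
def CompRandAchievable (W : 𝒳 → 𝒮 → 𝒴 × 𝒴₁ → ℝ) (C1 : ℝ) (Q : Set (𝒮 → ℝ)) (R : ℝ) :
    Prop :=
  ∀ ε > (0 : ℝ), ∃ N : ℕ, ∀ n ≥ N, ∃ (M L : ℕ),
    (2 : ℝ) ^ ((n : ℝ) * R) ≤ (M : ℝ) ∧ LinkOK n L C1 ∧
    ∃ (J : Type) (π : PMF J) (Cs : J → PCode 𝒳 𝒴 𝒴₁ n M L),
      ∀ q ∈ Q, (∑' j, π j * ENNReal.ofReal ((Cs j).errIID W q)) ≤ ENNReal.ofReal ε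

/-- The random code capacity of the compound primitive relay channel. -/
def CompRandCapacity (W : 𝒳 → 𝒮 → 𝒴 × 𝒴₁ → ℝ) (C1 : ℝ) (Q : Set (𝒮 → ℝ)) : ℝ :=
  sSup {R | CompRandAchievable W C1 Q R}

/-- `R` is achievable by deterministic codes over the primitive AVRC: the average
error is small under every joint state distribution. -/
def AVRCAchievable (W : 𝒳 → 𝒮 → 𝒴 × 𝒴₁ → ℝ) (C1 R : ℝ) : Prop :=
  ∀ ε > (0 : ℝ), ∃ N : ℕ, ∀ n ≥ N, ∃ (M L : ℕ) (C : PCode 𝒳 𝒴 𝒴₁ n M L),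
    (2 : ℝ) ^ ((n : ℝ) * R) ≤ (M : ℝ) ∧ LinkOK n L C1 ∧
    ∀ qn : (Fin n → 𝒮) → ℝ, IsPMF qn → C.errJoint W qn ≤ ε

/-- The deterministic code capacity of the primitive AVRC. -/
def AVRCCapacity (W : 𝒳 → 𝒮 → 𝒴 × 𝒴₁ → ℝ) (C1 : ℝ) : ℝ :=
  sSup {R | AVRCAchievable W C1 R}

/-- `R` is achievable by random codes over the primitive AVRC. -/
def AVRCRandAchievable (W : 𝒳 → 𝒮 → 𝒴 × 𝒴₁ → ℝ) (C1 R : ℝ) : Prop :=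
  ∀ ε > (0 : ℝ), ∃ N : ℕ, ∀ n ≥ N, ∃ (M L : ℕ),
    (2 : ℝ) ^ ((n : ℝ) * R) ≤ (M : ℝ) ∧ LinkOK n L C1 ∧
    ∃ (J : Type) (π : PMF J) (Cs : J → PCode 𝒳 𝒴 𝒴₁ n M L),
      ∀ qn : (Fin n → 𝒮) → ℝ, IsPMF qn →
        (∑' j, π j * ENNReal.ofReal ((Cs j).errJoint W qn)) ≤ ENNReal.ofReal ε

/-- The random code capacity of the primitive AVRC. -/
def AVRCRandCapacity (W : 𝒳 → 𝒮 → 𝒴 × 𝒴₁ → ℝ) (C1 : ℝ) : ℝ :=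
  sSup {R | AVRCRandAchievable W C1 R}

end Capacities

/-- The channel is reversely strongly degraded:
`W(y,y₁|x,s) = W_{Y|X,S}(y|x,s)·W_{Y₁|Y}(y₁|y)`. -/
def RevStronglyDegraded {𝒳 𝒮 𝒴 𝒴₁ : Type} [Fintype 𝒴] [Fintype 𝒴₁]
    (W : 𝒳 → 𝒮 → 𝒴 × 𝒴₁ → ℝ) : Prop :=
  ∃ (WY : 𝒳 → 𝒮 → 𝒴 → ℝ) (V : 𝒴 → 𝒴₁ → ℝ),
    (∀ x s, IsPMF (WY x s)) ∧ (∀ y, IsPMF (V y)) ∧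
    ∀ x s y y1, W x s (y, y1) = WY x s y * V y y1

/-- A state-dependent DMC `V(z|x,s)` is symmetrizable. -/
def Symmetrizable {𝒳 𝒮 𝒵 : Type} [Fintype 𝒮] (V : 𝒳 → 𝒮 → 𝒵 → ℝ) : Prop :=
  ∃ J : 𝒳 → 𝒮 → ℝ, (∀ x, IsPMF (J x)) ∧
    ∀ x x' z, (∑ s, V x s z * J x' s) = ∑ s, V x' s z * J x s

set_option linter.unusedSectionVars false

/-- Entropy in nats of a (not necessarily normalized) weight. -/
def entNat {α : Type} [Fintype α] (p : α → ℝ) : ℝ := ∑ a, Real.negMulLog (p a)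

/-- The mutual information in nats of input weight `p` and channel `K`, as `H(Z) - H(Z|X)`. -/
def chanInfo {α ζ : Type} [Fintype α] [Fintype ζ] (p : α → ℝ) (K : α → ζ → ℝ) : ℝ :=
  entNat (fun z => ∑ x, p x * K x z) - ∑ x, p x * entNat (K x)

lemma ent_eq {α : Type} [Fintype α] (p : α → ℝ) : ent p = entNat p / Real.log 2 := by
  simp only [ent, entNat, Real.negMulLog, Real.logb, Finset.sum_div, ← Finset.sum_neg_distrib]
  exact Finset.sum_congr rfl fun a _ => by ring

lemma entNat_mul {ζ : Type} [Fintype ζ] (c : ℝ) (v : ζ → ℝ) :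
    entNat (fun z => c * v z) = (∑ z, v z) * Real.negMulLog c + c * entNat v := by
  simp only [entNat, Real.negMulLog_mul, Finset.sum_add_distrib, ← Finset.sum_mul,
    ← Finset.mul_sum]

lemma continuous_entNat {α : Type} [Fintype α] : Continuous (entNat : (α → ℝ) → ℝ) := by
  unfold entNat
  fun_prop

lemma Continuous.entNat {α β : Type} [Fintype α] [TopologicalSpace β] {f : β → α → ℝ}
    (hf : Continuous f) : Continuous fun b => entNat (f b) :=
  continuous_entNat.comp hf

lemma mul_le_output {α ζ : Type} [Fintype α] {p : α → ℝ} {K : α → ζ → ℝ} (hp : ∀ x, 0 ≤ p x) (hK : ∀ x z, 0 ≤ K x z)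
    (x : α) (z : ζ) : p x * K x z ≤ ∑ x', p x' * K x' z :=
  Finset.single_le_sum (f := fun x' => p x' * K x' z)
    (fun x' _ => mul_nonneg (hp x') (hK x' z)) (Finset.mem_univ x)

section ChanInfo

variable {α β ζ : Type} [Fintype α] [Fintype β] [Fintype ζ]

lemma entNat_joint (p : α → ℝ) (K : α → ζ → ℝ) (hK : ∀ x, ∑ z, K x z = 1) :
    entNat (fun xz : α × ζ => p xz.1 * K xz.1 xz.2) = entNat p + ∑ x, p x * entNat (K x) := by
  have h : entNat (fun xz : α × ζ => p xz.1 * K xz.1 xz.2)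
      = ∑ x, entNat (fun z => p x * K x z) := by
    simp only [entNat, Fintype.sum_prod_type]
  rw [h]
  simp only [entNat_mul, hK, one_mul, Finset.sum_add_distrib]
  rfl

lemma mutInfo_eq_chanInfo (p : α → ℝ) (K : α → ζ → ℝ) (hK : ∀ x, ∑ z, K x z = 1) :
    mutInfo (fun xz : α × ζ => p xz.1 * K xz.1 xz.2) = chanInfo p K / Real.log 2 := by
  simp only [mutInfo, ent_eq, entNat_joint p K hK, chanInfo, ← Finset.mul_sum, hK, mul_one]
  ring

lemma sum_output (p : α → ℝ) (K : α → ζ → ℝ) (hK : ∀ x, ∑ z, K x z = 1) :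
    ∑ z, ∑ x, p x * K x z = ∑ x, p x := by
  rw [Finset.sum_comm]
  simp only [← Finset.mul_sum, hK, mul_one]

lemma continuous_chanInfo {γ : Type} [TopologicalSpace γ] {p : γ → α → ℝ} {K : γ → α → ζ → ℝ}
    (hp : Continuous p) (hK : Continuous K) : Continuous fun c => chanInfo (p c) (K c) := by
  unfold chanInfo
  refine (Continuous.entNat ?_).sub (continuous_finsetSum _ fun x _ => ?_)
  · fun_prop
  · exact ((continuous_apply x).comp hp).mul (Continuous.entNat ((continuous_apply x).comp hK))

lemma chanInfo_eq_sum (p : α → ℝ) (K : α → ζ → ℝ) :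
    chanInfo p K
      = ∑ z, ∑ x, p x * K x z * (Real.log (K x z) - Real.log (∑ x', p x' * K x' z)) := by
  simp only [chanInfo, entNat, Real.negMulLog, Finset.mul_sum]
  rw [Finset.sum_comm (f := fun x z => p x * _), ← Finset.sum_sub_distrib]
  refine Finset.sum_congr rfl fun z _ => ?_
  rw [neg_mul, Finset.sum_mul, ← Finset.sum_neg_distrib, ← Finset.sum_sub_distrib]
  exact Finset.sum_congr rfl fun x _ => by ring

/-- Variational lower bound on the mutual information. -/
lemma sum_mul_le_chanInfo {p : α → ℝ} {K : α → ζ → ℝ} (hp : IsPMF p) (hK : ∀ x, IsPMF (K x))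
    {f : α → ζ → ℝ} (hf : ∀ z, ∑ x, p x * Real.exp (f x z) ≤ 1) :
    ∑ x, p x * ∑ z, K x z * f x z ≤ chanInfo p K := by
  set r : ζ → ℝ := fun z => ∑ x', p x' * K x' z with hr
  have hr0 : ∀ z, 0 ≤ r z := fun z =>
    Finset.sum_nonneg fun x _ => mul_nonneg (hp.1 x) ((hK x).1 z)
  have key : ∀ z x, p x * K x z * f x z
      - p x * K x z * (Real.log (K x z) - Real.log (r z))
      ≤ r z * (p x * Real.exp (f x z)) - p x * K x z := by
    intro z x
    rcases (mul_nonneg (hp.1 x) ((hK x).1 z)).eq_or_lt with h | h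
    · rw [← h]
      have := mul_nonneg (hr0 z) (mul_nonneg (hp.1 x) (Real.exp_pos (f x z)).le)
      linarith
    · have hKp : 0 < K x z := lt_of_le_of_ne ((hK x).1 z) fun h0 => by simp [← h0] at h
      have hrp : 0 < r z := h.trans_le (mul_le_output hp.1 (fun x z => (hK x).1 z) x z)
      have h1 := Real.log_le_sub_one_of_pos
        (div_pos (mul_pos (Real.exp_pos (f x z)) hrp) hKp)
      rw [Real.log_div (by positivity) hKp.ne', Real.log_mul (by positivity) hrp.ne',
        Real.log_exp] at h1
      calc _ = p x * K x z * (f x z + Real.log (r z) - Real.log (K x z)) := by ring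
        _ ≤ p x * K x z * (Real.exp (f x z) * r z / K x z - 1) :=
            mul_le_mul_of_nonneg_left h1 h.le
        _ = _ := by field_simp
  have hsum : ∑ z, ∑ x, (p x * K x z * f x z
      - p x * K x z * (Real.log (K x z) - Real.log (r z))) ≤ 0 := by
    calc _ ≤ ∑ z, ∑ x, (r z * (p x * Real.exp (f x z)) - p x * K x z) :=
          Finset.sum_le_sum fun z _ => Finset.sum_le_sum fun x _ => key z x
      _ = ∑ z, (r z * ∑ x, p x * Real.exp (f x z) - r z) := by
          simp only [Finset.sum_sub_distrib, Finset.mul_sum, hr]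
      _ ≤ 0 := Finset.sum_nonpos fun z _ => by
          have := mul_le_mul_of_nonneg_left (hf z) (hr0 z)
          linarith
  simp only [Finset.sum_sub_distrib] at hsum
  rw [chanInfo_eq_sum]
  have : ∑ x, p x * ∑ z, K x z * f x z = ∑ z, ∑ x, p x * K x z * f x z := by
    rw [Finset.sum_comm]
    simp only [Finset.mul_sum, mul_assoc]
  linarith

/-- The variational bound is attained up to a small error by scores that are bounded uniformly
in the channel. -/
lemma exists_score {p : α → ℝ} (hp : IsPMF p) {δ : ℝ} (hδ : 0 < δ) :
    ∃ B : ℝ, 0 ≤ B ∧ ∀ K : α → ζ → ℝ, (∀ x, IsPMF (K x)) → ∃ f : α → ζ → ℝ,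
      (∀ x z, |f x z| ≤ B) ∧ (∀ z, ∑ x, p x * Real.exp (f x z) ≤ 1) ∧
      chanInfo p K - δ ≤ ∑ x, p x * ∑ z, K x z * f x z := by
  set τ : ℝ := 1 - Real.exp (-δ) with hτ
  have hτ1 : τ < 1 := by have := Real.exp_pos (-δ); linarith
  have hτ0 : 0 < τ := by
    have : Real.exp (-δ) < Real.exp 0 := Real.exp_lt_exp.2 (by linarith)
    rw [Real.exp_zero] at this
    linarith
  have hlogτ : 0 ≤ -Real.log τ := by
    have := Real.log_nonpos hτ0.le hτ1.le; linarith
  have hlp : ∀ x, 0 ≤ Real.log ((p x)⁻¹ + 1) := fun x =>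
    Real.log_nonneg (by have := inv_nonneg.2 (hp.1 x); linarith)
  refine ⟨-Real.log τ + ∑ x, Real.log ((p x)⁻¹ + 1),
    add_nonneg hlogτ (Finset.sum_nonneg fun x _ => hlp x), fun K hK => ?_⟩
  set r : ζ → ℝ := fun z => ∑ x', p x' * K x' z with hr
  have hr0 : ∀ z, 0 ≤ r z := fun z =>
    Finset.sum_nonneg fun x _ => mul_nonneg (hp.1 x) ((hK x).1 z)
  have hpos : ∀ x z, 0 < (1 - τ) * (K x z / r z) + τ := fun x z => by
    have := div_nonneg ((hK x).1 z) (hr0 z)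
    have := mul_nonneg (sub_nonneg.2 hτ1.le) this
    linarith
  refine ⟨fun x z => if p x = 0 then 0 else Real.log ((1 - τ) * (K x z / r z) + τ),
    fun x z => ?_, fun z => ?_, ?_⟩
  · have hS : Real.log ((p x)⁻¹ + 1) ≤ ∑ x, Real.log ((p x)⁻¹ + 1) :=
      Finset.single_le_sum (f := fun x => Real.log ((p x)⁻¹ + 1)) (fun x _ => hlp x)
        (Finset.mem_univ x)
    have := hlp x
    dsimp only
    split_ifs with h
    · simp only [abs_zero]; linarith
    · have hpx : 0 < p x := lt_of_le_of_ne (hp.1 x) (Ne.symm h)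
      have hKr : K x z / r z ≤ (p x)⁻¹ := by
        rcases (hr0 z).eq_or_lt with h0 | h0
        · rw [← h0, div_zero]; exact (inv_pos.2 hpx).le
        · rw [div_le_iff₀ h0, ← div_eq_inv_mul, le_div_iff₀ hpx, mul_comm]
          exact mul_le_output hp.1 (fun x z => (hK x).1 z) x z
      have hKr0 := div_nonneg ((hK x).1 z) (hr0 z)
      have h1 : Real.log τ ≤ Real.log ((1 - τ) * (K x z / r z) + τ) :=
        Real.log_le_log hτ0 (by nlinarith)
      have h2 : Real.log ((1 - τ) * (K x z / r z) + τ) ≤ Real.log ((p x)⁻¹ + 1) :=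
        Real.log_le_log (hpos x z) (by nlinarith)
      rw [abs_le]
      constructor <;> linarith
  · have hterm : ∀ x, p x * Real.exp
        (if p x = 0 then 0 else Real.log ((1 - τ) * (K x z / r z) + τ))
        = (1 - τ) * (p x * K x z / r z) + τ * p x := by
      intro x
      split_ifs with h
      · simp [h]
      · rw [Real.exp_log (hpos x z)]; ring
    simp only [hterm, Finset.sum_add_distrib, ← Finset.mul_sum, ← Finset.sum_div, hp.2]
    have : r z / r z ≤ 1 := div_self_le_one _
    change (1 - τ) * (r z / r z) + τ * 1 ≤ 1
    nlinarith
  · have hlogs : Real.log (1 - τ) = -δ := by rw [hτ]; simp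
    have hmass : ∑ x, ∑ z, p x * K x z = 1 := by
      simp only [← Finset.mul_sum, (hK _).2, mul_one, hp.2]
    have : chanInfo p K - δ = ∑ x, ∑ z, p x * K x z *
        (Real.log (1 - τ) + (Real.log (K x z) - Real.log (r z))) := by
      simp only [mul_add, Finset.sum_add_distrib, ← Finset.sum_mul, hmass, hlogs]
      rw [chanInfo_eq_sum, Finset.sum_comm]
      ring
    rw [this]
    simp only [Finset.mul_sum, ← mul_assoc]
    refine Finset.sum_le_sum fun x _ => Finset.sum_le_sum fun z _ => ?_
    rcases (mul_nonneg (hp.1 x) ((hK x).1 z)).eq_or_lt with h | h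
    · rw [← h]; simp
    · have hKp : 0 < K x z := lt_of_le_of_ne ((hK x).1 z) fun h0 => by simp [← h0] at h
      have hrp : 0 < r z := h.trans_le (mul_le_output hp.1 (fun x z => (hK x).1 z) x z)
      have hpx : p x ≠ 0 := fun h0 => by simp [h0] at h
      rw [if_neg hpx]
      refine mul_le_mul_of_nonneg_left ?_ h.le
      rw [← Real.log_div hKp.ne' hrp.ne', ← Real.log_mul (by linarith) (by positivity)]
      refine Real.log_le_log (mul_pos (by linarith) (by positivity)) (by linarith)

/-- Concavity of the mutual information in the input pmf. -/
lemma concave_chanInfo {p p' : α → ℝ} {K : α → ζ → ℝ} (hp : ∀ x, 0 ≤ p x) (hp' : ∀ x, 0 ≤ p' x)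
    (hK : ∀ x z, 0 ≤ K x z) {a b : ℝ} (ha : 0 ≤ a) (hb : 0 ≤ b) (hab : a + b = 1) :
    a * chanInfo p K + b * chanInfo p' K ≤ chanInfo (a • p + b • p') K := by
  have h1 : a * entNat (fun z => ∑ x, p x * K x z) + b * entNat (fun z => ∑ x, p' x * K x z)
      ≤ entNat (fun z => ∑ x, (a • p + b • p') x * K x z) := by
    simp only [entNat, Finset.mul_sum, ← Finset.sum_add_distrib]
    refine Finset.sum_le_sum fun z _ => ?_
    have := Real.concaveOn_negMulLog.2
      (Set.mem_Ici.2 (Finset.sum_nonneg fun x (_ : x ∈ Finset.univ) => mul_nonneg (hp x) (hK x z)))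
      (Set.mem_Ici.2 (Finset.sum_nonneg fun x (_ : x ∈ Finset.univ) => mul_nonneg (hp' x) (hK x z)))
      ha hb hab
    refine this.trans (le_of_eq (congrArg _ ?_))
    simp only [smul_eq_mul, Finset.mul_sum, ← Finset.sum_add_distrib, Pi.add_apply, Pi.smul_apply]
    exact Finset.sum_congr rfl fun x _ => by ring
  have h2 : ∑ x, (a • p + b • p') x * entNat (K x)
      = a * ∑ x, p x * entNat (K x) + b * ∑ x, p' x * entNat (K x) := by
    simp only [Finset.mul_sum, ← Finset.sum_add_distrib, Pi.add_apply, Pi.smul_apply, smul_eq_mul]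
    exact Finset.sum_congr rfl fun x _ => by ring
  simp only [chanInfo] at *
  rw [h2]
  linarith

/-- Convexity of the mutual information in the channel. -/
lemma convex_chanInfo {p : α → ℝ} {K K' : α → ζ → ℝ} (hp : IsPMF p) (hK : ∀ x, IsPMF (K x))
    (hK' : ∀ x, IsPMF (K' x)) {a b : ℝ} (ha : 0 ≤ a) (hb : 0 ≤ b) (hab : a + b = 1) :
    chanInfo p (a • K + b • K') ≤ a * chanInfo p K + b * chanInfo p K' := by
  refine le_of_forall_pos_le_add fun δ hδ => ?_
  obtain ⟨B, -, hB⟩ := exists_score (ζ := ζ) hp hδ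
  have hmix : ∀ x, IsPMF ((a • K + b • K') x) := fun x => by
    refine ⟨fun z => add_nonneg (mul_nonneg ha ((hK x).1 z)) (mul_nonneg hb ((hK' x).1 z)), ?_⟩
    simp [Finset.sum_add_distrib, ← Finset.mul_sum, (hK x).2, (hK' x).2, hab]
  obtain ⟨f, -, hf1, hf⟩ := hB _ hmix
  have e1 := mul_le_mul_of_nonneg_left (sum_mul_le_chanInfo hp hK hf1) ha
  have e2 := mul_le_mul_of_nonneg_left (sum_mul_le_chanInfo hp hK' hf1) hb
  have : ∑ x, p x * ∑ z, (a • K + b • K') x z * f x z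
      = a * ∑ x, p x * ∑ z, K x z * f x z + b * ∑ x, p x * ∑ z, K' x z * f x z := by
    simp only [Finset.mul_sum, ← Finset.sum_add_distrib, Pi.add_apply, Pi.smul_apply, smul_eq_mul]
    exact Finset.sum_congr rfl fun x _ => Finset.sum_congr rfl fun z _ => by ring
  linarith

/-- Data processing at the output, for normalized inputs. -/
lemma chanInfo_comp_le {p : α → ℝ} (hp : IsPMF p) {K : α → β → ℝ} (hK : ∀ x, IsPMF (K x))
    {V : β → ζ → ℝ} (hV : ∀ y, IsPMF (V y)) :
    chanInfo p (fun x z => ∑ y, K x y * V y z) ≤ chanInfo p K := by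
  refine le_of_forall_pos_le_add fun δ hδ => ?_
  obtain ⟨B, -, hB⟩ := exists_score (ζ := ζ) hp hδ
  have hcomp : ∀ x, IsPMF (fun z => ∑ y, K x y * V y z) := fun x =>
    ⟨fun z => Finset.sum_nonneg fun y _ => mul_nonneg ((hK x).1 y) ((hV y).1 z), by
      rw [sum_output _ _ fun y => (hV y).2, (hK x).2]⟩
  obtain ⟨f, -, hf1, hf⟩ := hB _ hcomp
  have hg : ∀ y, ∑ x, p x * Real.exp (∑ z, V y z * f x z) ≤ 1 := by
    intro y
    calc ∑ x, p x * Real.exp (∑ z, V y z * f x z)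
        ≤ ∑ x, p x * ∑ z, V y z * Real.exp (f x z) := by
          refine Finset.sum_le_sum fun x _ => mul_le_mul_of_nonneg_left ?_ (hp.1 x)
          have := convexOn_exp.map_sum_le (t := Finset.univ) (w := V y) (p := fun z => f x z)
            (fun z _ => (hV y).1 z) (hV y).2 (fun _ _ => Set.mem_univ _)
          simpa using this
      _ = ∑ z, V y z * ∑ x, p x * Real.exp (f x z) := by
          simp only [Finset.mul_sum]
          rw [Finset.sum_comm]
          exact Finset.sum_congr rfl fun x _ => Finset.sum_congr rfl fun z _ => by ring
      _ ≤ ∑ z, V y z * 1 := Finset.sum_le_sum fun z _ =>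
          mul_le_mul_of_nonneg_left (hf1 z) ((hV y).1 z)
      _ = 1 := by simp [(hV y).2]
  have h := sum_mul_le_chanInfo hp hK hg
  have : ∑ x, p x * ∑ z, (∑ y, K x y * V y z) * f x z
      = ∑ x, p x * ∑ y, K x y * ∑ z, V y z * f x z := by
    refine Finset.sum_congr rfl fun x _ => congrArg _ ?_
    simp only [Finset.mul_sum, Finset.sum_mul]
    rw [Finset.sum_comm]
    exact Finset.sum_congr rfl fun x _ => Finset.sum_congr rfl fun z _ => by ring
  linarith

lemma chanInfo_smul (c : ℝ) (p : α → ℝ) {K : α → ζ → ℝ} (hK : ∀ x, ∑ z, K x z = 1) :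
    chanInfo (fun x => c * p x) K = (∑ x, p x) * Real.negMulLog c + c * chanInfo p K := by
  simp only [chanInfo, mul_assoc, ← Finset.mul_sum]
  rw [entNat_mul, sum_output p K hK]
  ring

/-- Data processing at the output, for inputs of arbitrary mass. -/
lemma chanInfo_comp_le_of_nonneg {p : α → ℝ} (hp : ∀ x, 0 ≤ p x) {K : α → β → ℝ}
    (hK : ∀ x, IsPMF (K x)) {V : β → ζ → ℝ} (hV : ∀ y, IsPMF (V y)) :
    chanInfo p (fun x z => ∑ y, K x y * V y z) ≤ chanInfo p K := by
  have hcomp : ∀ x, ∑ z, ∑ y, K x y * V y z = 1 := fun x => by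
    rw [sum_output _ _ fun y => (hV y).2, (hK x).2]
  rcases (Finset.sum_nonneg fun x (_ : x ∈ Finset.univ) => hp x).eq_or_lt with h | h
  · have : ∀ x, p x = 0 := fun x =>
      (Finset.sum_eq_zero_iff_of_nonneg fun x _ => hp x).1 h.symm x (Finset.mem_univ x)
    simp [chanInfo, this, entNat]
  · set c := ∑ x, p x
    have hpc : p = fun x => c * (p x / c) := by
      funext x; field_simp
    have hpmf : IsPMF (fun x => p x / c) :=
      ⟨fun x => div_nonneg (hp x) h.le, by rw [← Finset.sum_div]; exact div_self h.ne'⟩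
    rw [hpc, chanInfo_smul _ _ hcomp, chanInfo_smul _ _ fun x => (hK x).2]
    have := mul_le_mul_of_nonneg_left (chanInfo_comp_le hpmf hK hV) h.le
    linarith

/-- An output component generated from the remaining output carries no further information. -/
lemma chanInfo_append (p : α → ℝ) (K : α → β → ℝ) {V : β → ζ → ℝ} (hV : ∀ y, ∑ z, V y z = 1) :
    chanInfo p (fun x (zy : ζ × β) => K x zy.2 * V zy.2 zy.1) = chanInfo p K := by
  have h : ∀ w : β → ℝ, entNat (fun zy : ζ × β => w zy.2 * V zy.2 zy.1)
      = entNat w + ∑ y, w y * entNat (V y) := by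
    intro w
    rw [← entNat_joint w V hV]
    simp only [entNat, Fintype.sum_prod_type]
    rw [Finset.sum_comm]
  simp only [chanInfo, ← mul_assoc, ← Finset.sum_mul]
  rw [h (fun y => ∑ x, p x * K x y)]
  simp only [h, mul_add, Finset.sum_add_distrib, Finset.mul_sum, Finset.sum_mul, ← mul_assoc]
  rw [Finset.sum_comm (s := (Finset.univ : Finset α)) (t := (Finset.univ : Finset β))]
  ring

end ChanInfo

@[fun_prop]
lemma Continuous.ent {α β : Type} [Fintype α] [TopologicalSpace β] {f : β → α → ℝ}
    (hf : Continuous f) : Continuous fun b => ent (f b) := by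
  simp only [ent_eq]
  exact hf.entNat.div_const _

lemma bddBelow_values {β : Type} [TopologicalSpace β] {Q : Set β} (hQ : IsCompact Q)
    {F : β → ℝ} (hF : Continuous F) : BddBelow {v | ∃ q ∈ Q, v = F q} := by
  obtain ⟨b, hb⟩ := (hQ.image hF).bddBelow
  exact ⟨b, fun v ⟨q, hq, hv⟩ => hb ⟨q, hq, hv.symm⟩⟩

lemma bddAbove_values {α : Type} [Fintype α] {F : (α → ℝ) → ℝ} (hF : Continuous F) :
    BddAbove {v | ∃ p, IsPMF p ∧ v = F p} := by
  obtain ⟨b, hb⟩ := ((isCompact_stdSimplex ℝ α).image hF).bddAbove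
  exact ⟨b, fun v ⟨p, hp, hv⟩ => hb ⟨p, hp, hv.symm⟩⟩

lemma nonempty_values {β : Type} {Q : Set β} (hQ : Q.Nonempty) (F : β → ℝ) :
    {v | ∃ q ∈ Q, v = F q}.Nonempty :=
  let ⟨q, hq⟩ := hQ
  ⟨_, q, hq, rfl⟩

lemma exists_isPMF (α : Type) [Fintype α] [Nonempty α] : ∃ p : α → ℝ, IsPMF p := by
  classical
  obtain ⟨a⟩ := ‹Nonempty α›
  exact ⟨Pi.single a 1, single_mem_stdSimplex ℝ a⟩

/-- The state-averaged channel from `X` to `(Y, Y₁)`. -/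
def pairChan {𝒳 𝒮 𝒵 : Type} [Fintype 𝒮] (W : 𝒳 → 𝒮 → 𝒵 → ℝ) (q : 𝒮 → ℝ) : 𝒳 → 𝒵 → ℝ :=
  fun x z => ∑ s, q s * W x s z

/-- The state-averaged channel from `X` to `Y`. -/
def outChan {𝒳 𝒮 𝒴 𝒴₁ : Type} [Fintype 𝒮] [Fintype 𝒴₁] (W : 𝒳 → 𝒮 → 𝒴 × 𝒴₁ → ℝ)
    (q : 𝒮 → ℝ) : 𝒳 → 𝒴 → ℝ :=
  fun x y => ∑ s, q s * ∑ y1, W x s (y, y1)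

section AuxiliaryVariable

variable {α ζ υ : Type} [Fintype α] [Fintype ζ] [Fintype υ]

lemma mutInfo_aux_eq (p : υ × α → ℝ) {K : α → ζ → ℝ} (hK : ∀ x, ∑ z, K x z = 1) :
    mutInfo (fun uz : υ × ζ => ∑ x, p (uz.1, x) * K x uz.2)
      = (entNat (fun u => ∑ x, p (u, x)) + entNat (fun z => ∑ x, (∑ u, p (u, x)) * K x z)
          - ∑ u, entNat (fun z => ∑ x, p (u, x) * K x z)) / Real.log 2 := by
  have h1 : ∀ u, ∑ z, ∑ x, p (u, x) * K x z = ∑ x, p (u, x) := fun u =>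
    sum_output (fun x => p (u, x)) K hK
  have h2 : ∀ z, ∑ u, ∑ x, p (u, x) * K x z = ∑ x, (∑ u, p (u, x)) * K x z := fun z => by
    rw [Finset.sum_comm]
    simp only [Finset.sum_mul]
  have h3 : entNat (fun uz : υ × ζ => ∑ x, p (uz.1, x) * K x uz.2)
      = ∑ u, entNat (fun z => ∑ x, p (u, x) * K x z) := by
    simp only [entNat, Fintype.sum_prod_type]
  simp only [mutInfo, ent_eq, h1, h2, h3]
  ring

lemma condMutInfo_aux_eq (p : υ × α → ℝ) {K : α → ζ → ℝ} (hK : ∀ x, ∑ z, K x z = 1) :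
    condMutInfo (fun uxz : υ × α × ζ => p (uxz.1, uxz.2.1) * K uxz.2.1 uxz.2.2)
      = ((∑ u, entNat (fun z => ∑ x, p (u, x) * K x z)) - entNat (fun u => ∑ x, p (u, x))
          - ∑ x, (∑ u, p (u, x)) * entNat (K x)) / Real.log 2 := by
  have h1 : entNat (fun uz : υ × ζ => ∑ x, p (uz.1, x) * K x uz.2)
      = ∑ u, entNat (fun z => ∑ x, p (u, x) * K x z) := by
    simp only [entNat, Fintype.sum_prod_type]
  have h2 : entNat (fun uxz : υ × α × ζ => p (uxz.1, uxz.2.1) * K uxz.2.1 uxz.2.2)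
      = entNat p + ∑ x, (∑ u, p (u, x)) * entNat (K x) := by
    have h := entNat_joint p (fun ux : υ × α => K ux.2) fun ux => hK ux.2
    have e : ∑ ux : υ × α, p ux * entNat (K ux.2) = ∑ x, (∑ u, p (u, x)) * entNat (K x) := by
      rw [Fintype.sum_prod_type, Finset.sum_comm]
      simp only [Finset.sum_mul]
    rw [← e, ← h]
    simp only [entNat, Fintype.sum_prod_type]
  simp only [condMutInfo, ent_eq, ← Finset.mul_sum, hK, mul_one, h1, h2]
  ring

end AuxiliaryVariable


section SingleLetter

variable {𝒳 𝒮 𝒴 𝒴₁ : Type} [Fintype 𝒳] [Fintype 𝒮] [Fintype 𝒴] [Fintype 𝒴₁]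
  {W : 𝒳 → 𝒮 → 𝒴 × 𝒴₁ → ℝ} {q : 𝒮 → ℝ}

lemma isPMF_pairChan (hW : IsChannel W) (hq : IsPMF q) (x : 𝒳) : IsPMF (pairChan W q x) :=
  ⟨fun z => Finset.sum_nonneg fun s _ => mul_nonneg (hq.1 s) ((hW x s).1 z), by
    rw [← hq.2]; exact sum_output q (W x) fun s => (hW x s).2⟩

lemma outChan_eq_sum_pairChan (W : 𝒳 → 𝒮 → 𝒴 × 𝒴₁ → ℝ) (q : 𝒮 → ℝ) (x : 𝒳) (y : 𝒴) :
    outChan W q x y = ∑ y1, pairChan W q x (y, y1) := by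
  simp only [outChan, pairChan, Finset.mul_sum]
  exact Finset.sum_comm

lemma isPMF_outChan (hW : IsChannel W) (hq : IsPMF q) (x : 𝒳) : IsPMF (outChan W q x) := by
  have h := isPMF_pairChan hW hq x
  refine ⟨fun y => ?_, ?_⟩
  · rw [outChan_eq_sum_pairChan]
    exact Finset.sum_nonneg fun y1 _ => h.1 _
  · simp only [outChan_eq_sum_pairChan]
    rw [← Fintype.sum_prod_type, h.2]

lemma continuous_outChan (W : 𝒳 → 𝒮 → 𝒴 × 𝒴₁ → ℝ) : Continuous (outChan W) := by
  unfold outChan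
  fun_prop

lemma IqXY_eq (hW : IsChannel W) (hq : IsPMF q) (p : 𝒳 → ℝ) :
    IqXY W p q = chanInfo p (outChan W q) / Real.log 2 :=
  mutInfo_eq_chanInfo p (outChan W q) fun x => (isPMF_outChan hW hq x).2

lemma IqXYY1_eq (hW : IsChannel W) (hq : IsPMF q) (p : 𝒳 → ℝ) :
    IqXYY1 W p q = chanInfo p (pairChan W q) / Real.log 2 :=
  mutInfo_eq_chanInfo p (pairChan W q) fun x => (isPMF_pairChan hW hq x).2

variable {W1 : 𝒳 → 𝒴₁ → ℝ} {V : 𝒴₁ → 𝒮 → 𝒴 → ℝ}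

lemma isPMF_relayToOut (hV : ∀ y1 s, IsPMF (V y1 s)) (hq : IsPMF q) (y1 : 𝒴₁) :
    IsPMF (fun y => ∑ s, q s * V y1 s y) :=
  ⟨fun y => Finset.sum_nonneg fun s _ => mul_nonneg (hq.1 s) ((hV y1 s).1 y), by
    rw [← hq.2]; exact sum_output q (V y1) fun s => (hV y1 s).2⟩

lemma pairChan_eq (hfact : ∀ x s y y1, W x s (y, y1) = W1 x y1 * V y1 s y) (q : 𝒮 → ℝ) :
    pairChan W q = fun x (z : 𝒴 × 𝒴₁) => W1 x z.2 * ∑ s, q s * V z.2 s z.1 := by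
  funext x z
  simp only [pairChan, Finset.mul_sum]
  refine Finset.sum_congr rfl fun s _ => ?_
  rw [show z = (z.1, z.2) from rfl, hfact]
  ring

lemma outChan_eq (hfact : ∀ x s y y1, W x s (y, y1) = W1 x y1 * V y1 s y) (q : 𝒮 → ℝ) :
    outChan W q = fun x y => ∑ y1, W1 x y1 * ∑ s, q s * V y1 s y := by
  funext x y
  rw [outChan_eq_sum_pairChan, pairChan_eq hfact]

lemma sum_pairChan_fst (hfact : ∀ x s y y1, W x s (y, y1) = W1 x y1 * V y1 s y)
    (hV : ∀ y1 s, IsPMF (V y1 s)) (hq : IsPMF q) (x : 𝒳) (y1 : 𝒴₁) :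
    ∑ y, pairChan W q x (y, y1) = W1 x y1 := by
  rw [pairChan_eq hfact]
  simp only [← Finset.mul_sum, (isPMF_relayToOut hV hq y1).2, mul_one]

lemma IqXYY1_eq_relay (hW : IsChannel W) (hV : ∀ y1 s, IsPMF (V y1 s))
    (hfact : ∀ x s y y1, W x s (y, y1) = W1 x y1 * V y1 s y) (hq : IsPMF q) (p : 𝒳 → ℝ) :
    IqXYY1 W p q = chanInfo p W1 / Real.log 2 := by
  rw [IqXYY1_eq hW hq, pairChan_eq hfact,
    chanInfo_append p W1 (V := fun y1 y => ∑ s, q s * V y1 s y)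
      fun y1 => (isPMF_relayToOut hV hq y1).2]

section DecodeForward

variable {k : ℕ}

lemma IqUY_eq (hW : IsChannel W) (hq : IsPMF q) (p : Fin k × 𝒳 → ℝ) :
    IqUY W p q = (entNat (fun u => ∑ x, p (u, x))
        + entNat (fun z => ∑ x, (∑ u, p (u, x)) * outChan W q x z)
        - ∑ u, entNat (fun z => ∑ x, p (u, x) * outChan W q x z)) / Real.log 2 := by
  rw [← mutInfo_aux_eq p fun x => (isPMF_outChan hW hq x).2]
  refine congrArg mutInfo (funext fun uy => Finset.sum_congr rfl fun x _ => ?_)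
  simp only [outChan, Finset.mul_sum, mul_assoc]

lemma IqUY1_eq (hW1 : ∀ x, IsPMF (W1 x)) (hV : ∀ y1 s, IsPMF (V y1 s))
    (hfact : ∀ x s y y1, W x s (y, y1) = W1 x y1 * V y1 s y) (hq : IsPMF q)
    (p : Fin k × 𝒳 → ℝ) :
    IqUY1 W p q = (entNat (fun u => ∑ x, p (u, x))
        + entNat (fun z => ∑ x, (∑ u, p (u, x)) * W1 x z)
        - ∑ u, entNat (fun z => ∑ x, p (u, x) * W1 x z)) / Real.log 2 := by
  rw [← mutInfo_aux_eq p fun x => (hW1 x).2]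
  refine congrArg mutInfo (funext fun uy => Finset.sum_congr rfl fun x _ => ?_)
  rw [← sum_pairChan_fst hfact hV hq]
  simp only [pairChan, Finset.mul_sum, mul_assoc]
  exact Finset.sum_comm

lemma IqXYgivenU_eq (hW : IsChannel W) (hq : IsPMF q) (p : Fin k × 𝒳 → ℝ) :
    IqXYgivenU W p q = ((∑ u, entNat (fun z => ∑ x, p (u, x) * outChan W q x z))
        - entNat (fun u => ∑ x, p (u, x))
        - ∑ x, (∑ u, p (u, x)) * entNat (outChan W q x)) / Real.log 2 :=
  condMutInfo_aux_eq (K := outChan W q) p fun x => (isPMF_outChan hW hq x).2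

lemma IqUY_add_IqXYgivenU (hW : IsChannel W) (hq : IsPMF q) (p : Fin k × 𝒳 → ℝ) :
    IqUY W p q + IqXYgivenU W p q = IqXY W (fun x => ∑ u, p (u, x)) q := by
  rw [IqUY_eq hW hq, IqXYgivenU_eq hW hq, IqXY_eq hW hq, chanInfo]
  ring

lemma IqUY1_add_IqXYgivenU_le (hW : IsChannel W) (hW1 : ∀ x, IsPMF (W1 x))
    (hV : ∀ y1 s, IsPMF (V y1 s)) (hfact : ∀ x s y y1, W x s (y, y1) = W1 x y1 * V y1 s y)
    (hq : IsPMF q) {p : Fin k × 𝒳 → ℝ} (hp : IsPMF p) :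
    IqUY1 W p q + IqXYgivenU W p q
      ≤ chanInfo (fun x => ∑ u, p (u, x)) W1 / Real.log 2 := by
  rw [IqUY1_eq hW1 hV hfact hq, IqXYgivenU_eq hW hq, ← add_div]
  refine div_le_div_of_nonneg_right ?_ (Real.log_nonneg one_le_two)
  have h : ∑ u, chanInfo (fun x => p (u, x)) (outChan W q)
      ≤ ∑ u, chanInfo (fun x => p (u, x)) W1 := Finset.sum_le_sum fun u _ => by
    rw [outChan_eq hfact]
    exact chanInfo_comp_le_of_nonneg (fun x => hp.1 (u, x)) hW1 (isPMF_relayToOut hV hq)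
  have e : ∀ {ζ : Type} [Fintype ζ] (K : 𝒳 → ζ → ℝ), ∑ u, ∑ x, p (u, x) * entNat (K x)
      = ∑ x, (∑ u, p (u, x)) * entNat (K x) := fun K => by
    rw [Finset.sum_comm]
    simp only [Finset.sum_mul]
  simp only [chanInfo, Finset.sum_sub_distrib, e] at h ⊢
  linarith

/-- The input pmf of `(U, X)` with `U` a relabelling of `X`. -/
def copyInput (e : Fin k ≃ 𝒳) (p : 𝒳 → ℝ) : Fin k × 𝒳 → ℝ := by
  classical exact fun ux => if e ux.1 = ux.2 then p ux.2 else 0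

lemma sum_copyInput_snd (e : Fin k ≃ 𝒳) (p : 𝒳 → ℝ) (u : Fin k) (g : 𝒳 → ℝ) :
    ∑ x, copyInput e p (u, x) * g x = p (e u) * g (e u) := by
  classical
  simp [copyInput, ite_mul, Finset.sum_ite_eq]

lemma sum_copyInput_fst (e : Fin k ≃ 𝒳) (p : 𝒳 → ℝ) (x : 𝒳) :
    ∑ u, copyInput e p (u, x) = p x := by
  classical
  rw [← Equiv.sum_comp e.symm]
  simp [copyInput]

lemma isPMF_copyInput (e : Fin k ≃ 𝒳) {p : 𝒳 → ℝ} (hp : IsPMF p) : IsPMF (copyInput e p) := by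
  refine ⟨fun ux => ?_, ?_⟩
  · unfold copyInput
    split_ifs
    exacts [hp.1 _, le_rfl]
  · rw [Fintype.sum_prod_type, Finset.sum_comm]
    simp only [sum_copyInput_fst, hp.2]

lemma entNat_copyInput (e : Fin k ≃ 𝒳) (p : 𝒳 → ℝ) {ζ : Type} [Fintype ζ] {K : 𝒳 → ζ → ℝ}
    (hK : ∀ x, ∑ z, K x z = 1) :
    ∑ u, entNat (fun z => ∑ x, copyInput e p (u, x) * K x z)
      = entNat p + ∑ x, p x * entNat (K x) := by
  simp only [sum_copyInput_snd e p _ (fun x => K x _)]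
  rw [Equiv.sum_comp e (fun x => entNat fun z => p x * K x z), ← entNat_joint p K hK]
  simp only [entNat, Fintype.sum_prod_type]

lemma entNat_copyInput_fst (e : Fin k ≃ 𝒳) (p : 𝒳 → ℝ) :
    entNat (fun u => ∑ x, copyInput e p (u, x)) = entNat p := by
  have h : ∀ u, ∑ x, copyInput e p (u, x) = p (e u) := fun u => by
    simpa using sum_copyInput_snd e p u fun _ => 1
  simp only [h, entNat]
  exact Equiv.sum_comp e fun x => Real.negMulLog (p x)

lemma IqUY_copyInput (hW : IsChannel W) (hq : IsPMF q) (e : Fin k ≃ 𝒳) (p : 𝒳 → ℝ) :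
    IqUY W (copyInput e p) q = IqXY W p q := by
  rw [IqUY_eq hW hq, IqXY_eq hW hq, entNat_copyInput e p fun x => (isPMF_outChan hW hq x).2,
    entNat_copyInput_fst]
  simp only [sum_copyInput_fst, chanInfo]
  ring

lemma IqUY1_copyInput (hW1 : ∀ x, IsPMF (W1 x)) (hV : ∀ y1 s, IsPMF (V y1 s))
    (hfact : ∀ x s y y1, W x s (y, y1) = W1 x y1 * V y1 s y) (hq : IsPMF q)
    (e : Fin k ≃ 𝒳) (p : 𝒳 → ℝ) :
    IqUY1 W (copyInput e p) q = chanInfo p W1 / Real.log 2 := by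
  rw [IqUY1_eq hW1 hV hfact hq, entNat_copyInput e p fun x => (hW1 x).2, entNat_copyInput_fst]
  simp only [sum_copyInput_fst, chanInfo]
  ring

lemma IqXYgivenU_copyInput (hW : IsChannel W) (hq : IsPMF q) (e : Fin k ≃ 𝒳) (p : 𝒳 → ℝ) :
    IqXYgivenU W (copyInput e p) q = 0 := by
  rw [IqXYgivenU_eq hW hq, entNat_copyInput e p fun x => (isPMF_outChan hW hq x).2,
    entNat_copyInput_fst]
  simp only [sum_copyInput_fst]
  ring

end DecodeForward

/-- The set of rates `min{ inf_q I_q(X;Y) + C₁, I(X;Y₁) }` over all input pmfs. -/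
def rateSet (W : 𝒳 → 𝒮 → 𝒴 × 𝒴₁ → ℝ) (C1 : ℝ) (Q : Set (𝒮 → ℝ)) (W1 : 𝒳 → 𝒴₁ → ℝ) : Set ℝ :=
  {r | ∃ p : 𝒳 → ℝ, IsPMF p ∧ r = min (sInf {v | ∃ q ∈ Q, v = IqXY W p q} + C1)
    (mutInfo (fun xy1 : 𝒳 × 𝒴₁ => p xy1.1 * W1 xy1.1 xy1.2))}

variable {C1 : ℝ} {Q : Set (𝒮 → ℝ)}

lemma rateSet_nonempty [Nonempty 𝒳] (W : 𝒳 → 𝒮 → 𝒴 × 𝒴₁ → ℝ) (C1 : ℝ) (Q : Set (𝒮 → ℝ))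
    (W1 : 𝒳 → 𝒴₁ → ℝ) : (rateSet W C1 Q W1).Nonempty :=
  let ⟨p, hp⟩ := exists_isPMF 𝒳
  ⟨_, p, hp, rfl⟩

lemma bddAbove_rateSet (W : 𝒳 → 𝒮 → 𝒴 × 𝒴₁ → ℝ) (C1 : ℝ) (Q : Set (𝒮 → ℝ))
    (W1 : 𝒳 → 𝒴₁ → ℝ) : BddAbove (rateSet W C1 Q W1) := by
  obtain ⟨b, hb⟩ := bddAbove_values (α := 𝒳)
    (F := fun p => mutInfo (fun xy1 : 𝒳 × 𝒴₁ => p xy1.1 * W1 xy1.1 xy1.2)) (by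
      unfold mutInfo
      fun_prop)
  refine ⟨b, ?_⟩
  rintro _ ⟨p, hp, rfl⟩
  exact (min_le_right _ _).trans (hb ⟨p, hp, rfl⟩)

lemma bddBelow_IqXY (W : 𝒳 → 𝒮 → 𝒴 × 𝒴₁ → ℝ) (hQ : IsCompact Q) (p : 𝒳 → ℝ) :
    BddBelow {v | ∃ q ∈ Q, v = IqXY W p q} :=
  bddBelow_values hQ (by unfold IqXY mutInfo; fun_prop)

lemma RDF_eq [Nonempty 𝒳] (hW : IsChannel W) (hQ : ∀ q ∈ Q, IsPMF q) (hQne : Q.Nonempty)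
    (hQcomp : IsCompact Q) (hW1 : ∀ x, IsPMF (W1 x)) (hV : ∀ y1 s, IsPMF (V y1 s))
    (hfact : ∀ x s y y1, W x s (y, y1) = W1 x y1 * V y1 s y) :
    RDF W C1 Q = sSup (rateSet W C1 Q W1) := by
  have hle : ∀ (k : ℕ) (p : Fin k × 𝒳 → ℝ), IsPMF p → min
      (sInf {v | ∃ q ∈ Q, v = IqUY W p q} + sInf {v | ∃ q ∈ Q, v = IqXYgivenU W p q} + C1)
      (sInf {v | ∃ q ∈ Q, v = IqUY1 W p q} + sInf {v | ∃ q ∈ Q, v = IqXYgivenU W p q})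
      ≤ sSup (rateSet W C1 Q W1) := by
    intro k p hp
    have b1 : BddBelow {v | ∃ q ∈ Q, v = IqUY W p q} :=
      bddBelow_values hQcomp (by unfold IqUY mutInfo; fun_prop)
    have b2 : BddBelow {v | ∃ q ∈ Q, v = IqUY1 W p q} :=
      bddBelow_values hQcomp (by unfold IqUY1 mutInfo; fun_prop)
    have b3 : BddBelow {v | ∃ q ∈ Q, v = IqXYgivenU W p q} :=
      bddBelow_values hQcomp (by unfold IqXYgivenU condMutInfo; fun_prop)
    have hpX : IsPMF (fun x => ∑ u, p (u, x)) :=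
      ⟨fun x => Finset.sum_nonneg fun u _ => hp.1 _, by
        rw [Finset.sum_comm, ← Fintype.sum_prod_type, hp.2]⟩
    refine le_trans (min_le_min ?_ ?_) (le_csSup (bddAbove_rateSet W C1 Q W1) ⟨_, hpX, rfl⟩)
    · refine add_le_add ?_ le_rfl
      refine le_csInf (nonempty_values hQne _) ?_
      rintro _ ⟨q, hq, rfl⟩
      rw [← IqUY_add_IqXYgivenU hW (hQ q hq)]
      exact add_le_add (csInf_le b1 ⟨q, hq, rfl⟩) (csInf_le b3 ⟨q, hq, rfl⟩)
    · obtain ⟨q, hq⟩ := hQne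
      rw [mutInfo_eq_chanInfo (fun x => ∑ u, p (u, x)) W1 fun x => (hW1 x).2]
      refine le_trans ?_ (IqUY1_add_IqXYgivenU_le hW hW1 hV hfact (hQ q hq) hp)
      exact add_le_add (csInf_le b2 ⟨q, hq, rfl⟩) (csInf_le b3 ⟨q, hq, rfl⟩)
  refine le_antisymm (csSup_le ?_ ?_) (csSup_le (rateSet_nonempty W C1 Q W1) ?_)
  · obtain ⟨p, hp⟩ := exists_isPMF 𝒳
    exact ⟨_, _, copyInput (Fintype.equivFin 𝒳).symm p, isPMF_copyInput _ hp, rfl⟩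
  · rintro _ ⟨k, p, hp, rfl⟩
    exact hle k p hp
  · rintro _ ⟨p, hp, rfl⟩
    refine le_csSup ⟨sSup (rateSet W C1 Q W1), ?_⟩
      ⟨_, copyInput (Fintype.equivFin 𝒳).symm p, isPMF_copyInput _ hp, ?_⟩
    · rintro _ ⟨k, p, hp, rfl⟩
      exact hle k p hp
    · have e1 : {v | ∃ q ∈ Q, v = IqUY W (copyInput (Fintype.equivFin 𝒳).symm p) q}
          = {v | ∃ q ∈ Q, v = IqXY W p q} := Set.ext fun v =>
        exists_congr fun q => and_congr_right fun hq => by rw [IqUY_copyInput hW (hQ q hq)]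
      have e2 : {v | ∃ q ∈ Q, v = IqUY1 W (copyInput (Fintype.equivFin 𝒳).symm p) q}
          = {chanInfo p W1 / Real.log 2} := by
        refine Set.eq_singleton_iff_nonempty_unique_mem.2 ⟨nonempty_values hQne _, ?_⟩
        rintro _ ⟨q, hq, rfl⟩
        exact IqUY1_copyInput hW1 hV hfact (hQ q hq) _ p
      have e3 : {v | ∃ q ∈ Q, v = IqXYgivenU W (copyInput (Fintype.equivFin 𝒳).symm p) q}
          = {0} := by
        refine Set.eq_singleton_iff_nonempty_unique_mem.2 ⟨nonempty_values hQne _, ?_⟩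
        rintro _ ⟨q, hq, rfl⟩
        exact IqXYgivenU_copyInput hW (hQ q hq) _ p
      rw [e1, e2, e3, mutInfo_eq_chanInfo _ _ fun x => (hW1 x).2]
      simp

end SingleLetter

section Minimax

variable {𝒳 𝒮 𝒴 𝒴₁ : Type} [Fintype 𝒳] [Fintype 𝒮] [Fintype 𝒴] [Fintype 𝒴₁]
  {W : 𝒳 → 𝒮 → 𝒴 × 𝒴₁ → ℝ} {W1 : 𝒳 → 𝒴₁ → ℝ} {V : 𝒴₁ → 𝒮 → 𝒴 → ℝ} {C1 : ℝ} {Q : Set (𝒮 → ℝ)}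

lemma outChan_combo (W : 𝒳 → 𝒮 → 𝒴 × 𝒴₁ → ℝ) (a b : ℝ) (q q' : 𝒮 → ℝ) :
    outChan W (a • q + b • q') = a • outChan W q + b • outChan W q' := by
  funext x y
  simp only [outChan, Pi.add_apply, Pi.smul_apply, smul_eq_mul, Finset.mul_sum,
    ← Finset.sum_add_distrib]
  exact Finset.sum_congr rfl fun s _ => Finset.sum_congr rfl fun y1 _ => by ring

lemma concaveOn_chanInfo {α ζ : Type} [Fintype α] [Fintype ζ] {K : α → ζ → ℝ}
    (hK : ∀ x, IsPMF (K x)) : ConcaveOn ℝ (stdSimplex ℝ α) fun p => chanInfo p K :=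
  ⟨convex_stdSimplex ℝ α, fun _ hp _ hp' _ _ ha hb hab => by
    simpa using concave_chanInfo hp.1 hp'.1 (fun x z => (hK x).1 z) ha hb hab⟩

lemma exists_saddle_rate [Nonempty 𝒳] (hW : IsChannel W) (hQ : ∀ q ∈ Q, IsPMF q)
    (hQne : Q.Nonempty) (hQcomp : IsCompact Q) (hQconv : Convex ℝ Q)
    (hW1 : ∀ x, IsPMF (W1 x)) (C : ℝ) :
    ∃ q₀ ∈ Q, ∃ p₀ ∈ stdSimplex ℝ 𝒳, IsSaddlePointOn Q (stdSimplex ℝ 𝒳)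
      (fun q p => min (chanInfo p (outChan W q) + C) (chanInfo p W1)) q₀ p₀ := by
  refine Sion.exists_isSaddlePointOn hQne hQconv hQcomp (fun p hp => ?_) (fun p hp => ?_)
    (convex_stdSimplex ℝ 𝒳) (exists_isPMF 𝒳) (isCompact_stdSimplex ℝ 𝒳)
    (fun q hq => ?_) (fun q hq => ?_)
  · exact (((continuous_chanInfo continuous_const (continuous_outChan W)).add
      continuous_const).min continuous_const).lowerSemicontinuous.lowerSemicontinuousOn _
  · rw [quasiconvexOn_iff_le_max]
    refine ⟨hQconv, fun q hq q' hq' a b ha hb hab => ?_⟩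
    rw [← min_max_distrib_right]
    refine min_le_min ?_ le_rfl
    have h := convex_chanInfo hp (isPMF_outChan hW (hQ q hq)) (isPMF_outChan hW (hQ q' hq'))
      ha hb hab
    rw [← outChan_combo] at h
    have h1 := mul_le_mul_of_nonneg_left (le_max_left (chanInfo p (outChan W q) + C)
      (chanInfo p (outChan W q') + C)) ha
    have h2 := mul_le_mul_of_nonneg_left (le_max_right (chanInfo p (outChan W q) + C)
      (chanInfo p (outChan W q') + C)) hb
    have h3 : ∀ t : ℝ, a * t + b * t = t := fun t => by rw [← add_mul, hab, one_mul]
    have := h3 C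
    have := h3 (max (chanInfo p (outChan W q) + C) (chanInfo p (outChan W q') + C))
    linarith
  · exact (((continuous_chanInfo continuous_id continuous_const).add
      continuous_const).min
        (continuous_chanInfo continuous_id continuous_const)).upperSemicontinuous.upperSemicontinuousOn _
  · exact (((concaveOn_chanInfo (isPMF_outChan hW (hQ q hq))).add
      (concaveOn_const C (convex_stdSimplex ℝ 𝒳))).inf
        (concaveOn_chanInfo hW1)).quasiconcaveOn

lemma bddAbove_cutset (W : 𝒳 → 𝒮 → 𝒴 × 𝒴₁ → ℝ) (C1 : ℝ) (q : 𝒮 → ℝ) :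
    BddAbove {v | ∃ p : 𝒳 → ℝ, IsPMF p ∧ v = min (IqXY W p q + C1) (IqXYY1 W p q)} :=
  bddAbove_values (by unfold IqXY IqXYY1 mutInfo; fun_prop)

lemma RCS_eq [Nonempty 𝒳] (hW : IsChannel W) (hQ : ∀ q ∈ Q, IsPMF q) (hQne : Q.Nonempty)
    (hQcomp : IsCompact Q) (hQconv : Convex ℝ Q) (hW1 : ∀ x, IsPMF (W1 x))
    (hV : ∀ y1 s, IsPMF (V y1 s))
    (hfact : ∀ x s y y1, W x s (y, y1) = W1 x y1 * V y1 s y) :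
    RCS W C1 Q = sSup (rateSet W C1 Q W1) := by
  have hlow : ∀ q ∈ Q, sSup (rateSet W C1 Q W1)
      ≤ sSup {v | ∃ p : 𝒳 → ℝ, IsPMF p ∧ v = min (IqXY W p q + C1) (IqXYY1 W p q)} := by
    intro q hq
    refine csSup_le (rateSet_nonempty W C1 Q W1) ?_
    rintro _ ⟨p, hp, rfl⟩
    refine le_trans ?_ (le_csSup (bddAbove_cutset W C1 q) ⟨p, hp, rfl⟩)
    rw [IqXYY1_eq_relay hW hV hfact (hQ q hq), mutInfo_eq_chanInfo p W1 fun x => (hW1 x).2]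
    exact min_le_min (add_le_add (csInf_le (bddBelow_IqXY W hQcomp p) ⟨q, hq, rfl⟩) le_rfl) le_rfl
  refine le_antisymm ?_ (le_csInf (nonempty_values hQne _) ?_)
  · obtain ⟨q₀, hq₀, p₀, hp₀, hs⟩ :=
      exists_saddle_rate hW hQ hQne hQcomp hQconv hW1 (C1 * Real.log 2)
    refine le_trans (csInf_le ⟨sSup (rateSet W C1 Q W1), ?_⟩ ⟨q₀, hq₀, rfl⟩) ?_
    · rintro _ ⟨q, hq, rfl⟩
      exact hlow q hq
    have hl2 : 0 < Real.log 2 := Real.log_pos one_lt_two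
    have hval : ∀ q ∈ Q, ∀ p, min (IqXY W p q + C1) (IqXYY1 W p q)
        = min (chanInfo p (outChan W q) + C1 * Real.log 2) (chanInfo p W1) / Real.log 2 := by
      intro q hq p
      rw [IqXYY1_eq_relay hW hV hfact (hQ q hq), IqXY_eq hW (hQ q hq), ← min_div_div_right hl2.le,
        add_div, mul_div_cancel_right₀ _ hl2.ne']
    refine csSup_le ?_ ?_
    · obtain ⟨p, hp⟩ := exists_isPMF 𝒳
      exact ⟨_, p, hp, rfl⟩
    rintro _ ⟨p, hp, rfl⟩
    have hle : ∀ q ∈ Q, min (IqXY W p q₀ + C1) (IqXYY1 W p q₀)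
        ≤ min (IqXY W p₀ q + C1) (IqXYY1 W p₀ q) := by
      intro q hq
      rw [hval q hq, hval q₀ hq₀]
      exact div_le_div_of_nonneg_right (hs q hq p hp) hl2.le
    refine le_trans (le_min ?_ ?_)
      (le_csSup (bddAbove_rateSet W C1 Q W1) ⟨p₀, hp₀, rfl⟩)
    · rw [← sub_le_iff_le_add]
      refine le_csInf (nonempty_values hQne _) ?_
      rintro _ ⟨q, hq, rfl⟩
      rw [sub_le_iff_le_add]
      exact (hle q hq).trans (min_le_left _ _)
    · obtain ⟨q, hq⟩ := hQne
      rw [mutInfo_eq_chanInfo p₀ W1 fun x => (hW1 x).2, ← IqXYY1_eq_relay hW hV hfact (hQ q hq)]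
      exact (hle q hq).trans (min_le_right _ _)
  · rintro _ ⟨q, hq, rfl⟩
    exact hlow q hq

lemma exists_saddle_of_biaffine {E F : Type} [TopologicalSpace E] [AddCommGroup E] [Module ℝ E]
    [IsTopologicalAddGroup E] [ContinuousSMul ℝ E] [TopologicalSpace F] [AddCommGroup F]
    [Module ℝ F] [IsTopologicalAddGroup F] [ContinuousSMul ℝ F] {A : Set E} {S : Set F}
    (hA : Convex ℝ A) (hAc : IsCompact A) (hAne : A.Nonempty) (hS : Convex ℝ S)
    (hSc : IsCompact S) (hSne : S.Nonempty) (Φ : E → F → ℝ)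
    (hc1 : ∀ f, Continuous fun q => Φ q f) (hc2 : ∀ q, Continuous (Φ q))
    (h1 : ∀ (f : F) (a b : ℝ) (q q' : E), Φ (a • q + b • q') f = a * Φ q f + b * Φ q' f)
    (h2 : ∀ (q : E) (a b : ℝ) (f g : F), Φ q (a • f + b • g) = a * Φ q f + b * Φ q g) :
    ∃ q₀ ∈ A, ∃ f₀ ∈ S, IsSaddlePointOn A S Φ q₀ f₀ :=
  Sion.exists_isSaddlePointOn hAne hA hAc
    (fun f _ => (hc1 f).lowerSemicontinuous.lowerSemicontinuousOn _)
    (fun f _ => ConvexOn.quasiconvexOn ⟨hA, fun q _ q' _ a b _ _ _ => (h1 f a b q q').le⟩)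
    hS hSne hSc
    (fun q _ => (hc2 q).upperSemicontinuous.upperSemicontinuousOn _)
    (fun q _ => ConcaveOn.quasiconcaveOn ⟨hS, fun f _ g _ a b _ _ _ => (h2 q a b f g).ge⟩)

/-- The scores bounded by `B` whose exponential moment is at most one at every output. -/
def scoreSet {ζ : Type} (p : 𝒳 → ℝ) (B : ℝ) : Set (𝒳 → ζ → ℝ) :=
  Set.Icc (fun _ _ => -B) (fun _ _ => B) ∩ {f | ∀ y, ∑ x, p x * Real.exp (f x y) ≤ 1}

lemma convex_scoreSet {ζ : Type} {p : 𝒳 → ℝ} (hp : IsPMF p) (B : ℝ) :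
    Convex ℝ (scoreSet (ζ := ζ) p B) := by
  refine (convex_Icc _ _).inter fun f hf g hg a b ha hb hab y => ?_
  calc ∑ x, p x * Real.exp ((a • f + b • g) x y)
      ≤ ∑ x, p x * (a * Real.exp (f x y) + b * Real.exp (g x y)) :=
        Finset.sum_le_sum fun x _ => mul_le_mul_of_nonneg_left
          (convexOn_exp.2 (Set.mem_univ _) (Set.mem_univ _) ha hb hab) (hp.1 x)
    _ = a * ∑ x, p x * Real.exp (f x y) + b * ∑ x, p x * Real.exp (g x y) := by
        simp only [Finset.mul_sum, ← Finset.sum_add_distrib]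
        exact Finset.sum_congr rfl fun x _ => by ring
    _ ≤ a * 1 + b * 1 := add_le_add (mul_le_mul_of_nonneg_left (hf y) ha)
        (mul_le_mul_of_nonneg_left (hg y) hb)
    _ = 1 := by linarith

lemma isCompact_scoreSet {ζ : Type} (p : 𝒳 → ℝ) (B : ℝ) :
    IsCompact (scoreSet (ζ := ζ) p B) := by
  refine isCompact_Icc.inter_right ?_
  simp only [Set.ofPred_forall]
  exact isClosed_iInter fun y => isClosed_le (by fun_prop) continuous_const

/-- A single bounded score that is nearly optimal against every state pmf. -/
lemma exists_universal_score (hW : IsChannel W) (hQ : ∀ q ∈ Q, IsPMF q)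
    (hQne : Q.Nonempty) (hQcomp : IsCompact Q) (hQconv : Convex ℝ Q) {p : 𝒳 → ℝ} (hp : IsPMF p)
    {t : ℝ} (ht : ∀ q ∈ Q, t < chanInfo p (outChan W q)) {δ : ℝ} (hδ : 0 < δ) :
    ∃ B : ℝ, 0 ≤ B ∧ ∃ f : 𝒳 → 𝒴 → ℝ, (∀ x y, |f x y| ≤ B) ∧
      (∀ y, ∑ x, p x * Real.exp (f x y) ≤ 1) ∧
      ∀ q ∈ Q, t - δ ≤ ∑ x, p x * ∑ y, outChan W q x y * f x y := by
  obtain ⟨B, hB0, hB⟩ := exists_score (ζ := 𝒴) hp hδ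
  refine ⟨B, hB0, ?_⟩
  have hmem : ∀ f : 𝒳 → 𝒴 → ℝ, (∀ x y, |f x y| ≤ B) →
      (∀ y, ∑ x, p x * Real.exp (f x y) ≤ 1) → f ∈ scoreSet p B := fun f h1 h2 =>
    ⟨⟨fun x y => (abs_le.1 (h1 x y)).1, fun x y => (abs_le.1 (h1 x y)).2⟩, h2⟩
  have hne : (scoreSet (ζ := 𝒴) p B).Nonempty := by
    obtain ⟨q, hq⟩ := hQne
    obtain ⟨f, h1, h2, -⟩ := hB _ (isPMF_outChan hW (hQ q hq))
    exact ⟨f, hmem f h1 h2⟩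
  have hcont := continuous_outChan W
  obtain ⟨q₀, hq₀, f₀, hf₀, hs⟩ := exists_saddle_of_biaffine hQconv hQcomp hQne
    (convex_scoreSet hp B) (isCompact_scoreSet p B) hne
    (fun q f => ∑ x, p x * ∑ y, outChan W q x y * f x y)
    (fun f => by fun_prop) (fun q => by fun_prop)
    (fun f a b q q' => by
      rw [outChan_combo]
      simp only [Finset.mul_sum, ← Finset.sum_add_distrib, Pi.add_apply, Pi.smul_apply, smul_eq_mul]
      exact Finset.sum_congr rfl fun x _ => Finset.sum_congr rfl fun y _ => by ring)
    (fun q a b f g => by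
      simp only [Finset.mul_sum, ← Finset.sum_add_distrib, Pi.add_apply, Pi.smul_apply, smul_eq_mul]
      exact Finset.sum_congr rfl fun x _ => Finset.sum_congr rfl fun y _ => by ring)
  refine ⟨f₀, fun x y => abs_le.2 ⟨hf₀.1.1 x y, hf₀.1.2 x y⟩, hf₀.2, fun q hq => ?_⟩
  obtain ⟨f, h1, h2, h3⟩ := hB _ (isPMF_outChan hW (hQ q₀ hq₀))
  have h4 := hs q hq f (hmem f h1 h2)
  have h5 := ht q₀ hq₀
  dsimp only at h4
  linarith

end Minimax

section Converse

variable {α ζ : Type} [Fintype α] [Fintype ζ] {n M : ℕ}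

lemma sum_prod_pi [DecidableEq (Fin n)] (u : Fin n → ζ → ℝ) :
    ∑ z : Fin n → ζ, ∏ i, u i (z i) = ∏ i, ∑ z, u i z :=
  (Fintype.prod_sum u).symm

lemma sum_prod_pi_mul (u : Fin n → ζ → ℝ) (hu : ∀ i, ∑ z, u i z = 1) (i : Fin n) (h : ζ → ℝ) :
    ∑ z : Fin n → ζ, (∏ j, u j (z j)) * h (z i) = ∑ z, u i z * h z := by
  classical
  have key : ∀ z : Fin n → ζ, (∏ j, u j (z j)) * h (z i)
      = ∏ j, (if j = i then u j (z j) * h (z j) else u j (z j)) := by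
    intro z
    have : ∀ j, (if j = i then u j (z j) * h (z j) else u j (z j))
        = u j (z j) * (if j = i then h (z j) else 1) := by
      intro j; split_ifs <;> simp
    simp only [this, Finset.prod_mul_distrib, Finset.prod_ite_eq', Finset.mem_univ, if_true]
  simp only [key]
  rw [sum_prod_pi fun j z => if j = i then u j z * h z else u j z]
  rw [Finset.prod_eq_single i]
  · simp
  · intro j _ hj
    simp [hj, hu]
  · simp

/-- The empirical input distribution of a codebook. -/
def inputType [DecidableEq α] (c : Fin M → Fin n → α) (x : α) : ℝ :=
  ((n : ℝ) * M)⁻¹ * ∑ m, ∑ i, if c m i = x then 1 else 0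

lemma sum_inputType_mul [DecidableEq α] (c : Fin M → Fin n → α) (h : α → ℝ) :
    ∑ x, inputType c x * h x = ((n : ℝ) * M)⁻¹ * ∑ m, ∑ i, h (c m i) := by
  simp only [inputType, mul_assoc, ← Finset.mul_sum, Finset.sum_mul]
  congr 1
  rw [Finset.sum_comm]
  refine Finset.sum_congr rfl fun m _ => ?_
  rw [Finset.sum_comm]
  exact Finset.sum_congr rfl fun i _ => by simp

lemma inputType_pos [DecidableEq α] (c : Fin M → Fin n → α) (m : Fin M) (i : Fin n) :
    0 < inputType c (c m i) := by
  have hn : (0 : ℝ) < n := by exact_mod_cast i.pos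
  have hM : (0 : ℝ) < M := by exact_mod_cast m.pos
  refine mul_pos (by positivity) ?_
  refine Finset.sum_pos' (fun m _ => Finset.sum_nonneg fun i _ => by positivity)
    ⟨m, Finset.mem_univ _, ?_⟩
  exact Finset.sum_pos' (fun i _ => by positivity) ⟨i, Finset.mem_univ _, by simp⟩

lemma inputType_nonneg [DecidableEq α] (c : Fin M → Fin n → α) (x : α) : 0 ≤ inputType c x :=
  mul_nonneg (by positivity)
    (Finset.sum_nonneg fun m _ => Finset.sum_nonneg fun i _ => by positivity)

lemma isPMF_inputType [DecidableEq α] (hn : 0 < n) (hM : 0 < M) (c : Fin M → Fin n → α) :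
    IsPMF (inputType c) := by
  refine ⟨inputType_nonneg c, ?_⟩
  have := sum_inputType_mul c fun _ => 1
  simp only [mul_one, Finset.sum_const, Finset.card_univ, Fintype.card_fin, nsmul_eq_mul] at this
  rw [this, mul_comm (n : ℝ)]
  exact inv_mul_cancel₀ (by positivity)

/-- A list-decoding form of Fano's inequality, with the single-letter information evaluated at
the empirical input distribution of the codebook. -/
lemma log_mul_success_le [DecidableEq α] (hn : 0 < n) (hM : 0 < M) (c : Fin M → Fin n → α)
    {K : α → ζ → ℝ} (hK : ∀ x, IsPMF (K x)) (A : Fin M → (Fin n → ζ) → Prop)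
    [∀ m z, Decidable (A m z)] {L : ℕ} (hL : ∀ z, (Finset.univ.filter (A · z)).card ≤ L) :
    ((M : ℝ)⁻¹ * ∑ m, ∑ z, if A m z then ∏ i, K (c m i) (z i) else 0) * Real.log M
      ≤ n * chanInfo (inputType c) K + Real.log (1 + L) := by
  have hnR : (0 : ℝ) < n := by exact_mod_cast hn
  have hMR : (0 : ℝ) < M := by exact_mod_cast hM
  have hLR : (0 : ℝ) < 1 + L := by positivity
  set r : ζ → ℝ := fun z => ∑ x, inputType c x * K x z with hr
  have hr0 : ∀ z, 0 ≤ r z := fun z =>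
    Finset.sum_nonneg fun x _ => mul_nonneg (inputType_nonneg c x) ((hK x).1 z)
  have hr1 : ∑ z, r z = 1 := by
    simp only [hr]
    rw [Finset.sum_comm]
    simp only [← Finset.mul_sum, (hK _).2, mul_one]
    exact (isPMF_inputType hn hM c).2
  set P : Fin M → (Fin n → ζ) → ℝ := fun m z => ∏ i, K (c m i) (z i) with hP
  have hP0 : ∀ m z, 0 ≤ P m z := fun m z => Finset.prod_nonneg fun i _ => (hK _).1 _
  have hP1 : ∀ m, ∑ z, P m z = 1 := by
    intro m
    simp only [hP]
    rw [sum_prod_pi fun i z => K (c m i) z]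
    simp [(hK _).2]
  set w : Fin M → (Fin n → ζ) → ℝ := fun m z => if A m z then (M : ℝ) else 1 with hw
  have hw0 : ∀ m z, 0 < w m z := by
    intro m z; simp only [hw]; split_ifs <;> positivity
  have hterm : ∀ m z, P m z * (Real.log (w m z)
      - ∑ i, (Real.log (K (c m i) (z i)) - Real.log (r (z i))))
      ≤ w m z * (∏ i, r (z i)) / (1 + L) + P m z * (Real.log (1 + L) - 1) := by
    intro m z
    have hrp : 0 ≤ ∏ i, r (z i) := Finset.prod_nonneg fun i _ => hr0 _
    rcases (hP0 m z).eq_or_lt with h0 | hpos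
    · rw [← h0]
      have := (hw0 m z).le
      simp only [zero_mul, add_zero]
      positivity
    have hKpos : ∀ i, 0 < K (c m i) (z i) := fun i =>
      lt_of_le_of_ne ((hK _).1 _) fun h =>
        hpos.ne' (Finset.prod_eq_zero (Finset.mem_univ i) h.symm)
    have hrpos : ∀ i, 0 < r (z i) := fun i =>
      lt_of_lt_of_le (mul_pos (inputType_pos c m i) (hKpos i))
        (Finset.single_le_sum (f := fun x => inputType c x * K x (z i))
          (fun x _ => mul_nonneg (inputType_nonneg c x) ((hK x).1 _)) (Finset.mem_univ _))
    have hrP : 0 < ∏ i, r (z i) := Finset.prod_pos fun i _ => hrpos i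
    have h1 := Real.log_le_sub_one_of_pos
      (show 0 < w m z * (∏ i, r (z i)) / (1 + L) / P m z by
        have := hw0 m z; positivity)
    rw [Real.log_div (by have := hw0 m z; positivity) hpos.ne',
      Real.log_div (by have := hw0 m z; positivity) hLR.ne',
      Real.log_mul (hw0 m z).ne' hrP.ne', Real.log_prod (fun i _ => (hrpos i).ne'),
      show Real.log (P m z) = ∑ i, Real.log (K (c m i) (z i)) from
        Real.log_prod fun i _ => (hKpos i).ne'] at h1
    rw [Finset.sum_sub_distrib]
    have h2 := mul_le_mul_of_nonneg_left h1 hpos.le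
    rw [mul_sub (P m z) (_ / P m z), mul_div_cancel₀ _ hpos.ne'] at h2
    linarith
  have hsum := Finset.sum_le_sum fun m (_ : m ∈ Finset.univ) =>
    Finset.sum_le_sum fun z (_ : z ∈ Finset.univ) => hterm m z
  have hwsum : ∑ m, ∑ z, w m z * (∏ i, r (z i)) / (1 + L) ≤ M := by
    rw [Finset.sum_comm]
    have hz : ∀ z : Fin n → ζ, ∑ m, w m z * (∏ i, r (z i)) / (1 + L) ≤ M * ∏ i, r (z i) := by
      intro z
      rw [← Finset.sum_div, ← Finset.sum_mul, div_le_iff₀ hLR]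
      have : ∑ m, w m z ≤ M * (1 + L) := by
        have hb : ∀ m, w m z ≤ (if A m z then (M : ℝ) else 0) + 1 := by
          intro m; simp only [hw]; split_ifs <;> simp
        refine (Finset.sum_le_sum fun m _ => hb m).trans ?_
        rw [Finset.sum_add_distrib, ← Finset.sum_filter, Finset.sum_const, Finset.sum_const]
        have : ((Finset.univ.filter (A · z)).card : ℝ) ≤ L := by exact_mod_cast hL z
        simp only [nsmul_eq_mul, Finset.card_univ, Fintype.card_fin, mul_one]
        nlinarith
      calc (∑ m, w m z) * ∏ i, r (z i) ≤ (M * (1 + L)) * ∏ i, r (z i) :=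
            mul_le_mul_of_nonneg_right this (Finset.prod_nonneg fun i _ => hr0 _)
        _ = _ := by ring
    refine (Finset.sum_le_sum fun z _ => hz z).trans ?_
    rw [← Finset.mul_sum, sum_prod_pi fun _ z => r z]
    simp [hr1]
  have hinfo : ∑ m, ∑ z, P m z * ∑ i, (Real.log (K (c m i) (z i)) - Real.log (r (z i)))
      = n * M * chanInfo (inputType c) K := by
    rw [chanInfo_eq_sum, Finset.sum_comm (s := (Finset.univ : Finset ζ))]
    simp only [mul_assoc (inputType c _), ← Finset.mul_sum]
    rw [sum_inputType_mul c fun x => ∑ z, K x z * (Real.log (K x z) - Real.log (r z)),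
      mul_inv_cancel_left₀ (by positivity)]
    refine Finset.sum_congr rfl fun m _ => ?_
    simp only [Finset.mul_sum]
    rw [Finset.sum_comm]
    exact Finset.sum_congr rfl fun i _ => sum_prod_pi_mul (fun j z => K (c m j) z)
      (fun j => (hK _).2) i fun z => Real.log (K (c m i) z) - Real.log (r z)
  have hsucc : ∑ m, ∑ z, P m z * Real.log (w m z)
      = (∑ m, ∑ z, if A m z then P m z else 0) * Real.log M := by
    simp only [Finset.sum_mul]
    refine Finset.sum_congr rfl fun m _ => Finset.sum_congr rfl fun z _ => ?_
    simp only [hw]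
    split_ifs <;> simp
  have hsplit : ∀ a b : Fin M → (Fin n → ζ) → ℝ, ∑ m, ∑ z, P m z * (a m z - b m z)
      = ∑ m, ∑ z, P m z * a m z - ∑ m, ∑ z, P m z * b m z := fun a b => by
    simp only [mul_sub, Finset.sum_sub_distrib]
  rw [hsplit fun m z => Real.log (w m z)] at hsum
  simp only [Finset.sum_add_distrib, ← Finset.sum_mul, hP1, Finset.sum_const, Finset.card_univ,
    Fintype.card_fin, nsmul_eq_mul, mul_one] at hsum
  rw [hinfo, hsucc] at hsum
  rw [mul_assoc, inv_mul_le_iff₀ hMR]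
  nlinarith

end Converse

section CodeConverse

variable {𝒳 𝒮 𝒴 𝒴₁ : Type} [Fintype 𝒳] [Fintype 𝒮] [Fintype 𝒴] [Fintype 𝒴₁]
  {W : 𝒳 → 𝒮 → 𝒴 × 𝒴₁ → ℝ} {W1 : 𝒳 → 𝒴₁ → ℝ} {V : 𝒴₁ → 𝒮 → 𝒴 → ℝ} {C1 : ℝ} {Q : Set (𝒮 → ℝ)}
  {n M L : ℕ}

lemma errIID_eq (C : PCode 𝒳 𝒴 𝒴₁ n M L) (W : 𝒳 → 𝒮 → 𝒴 × 𝒴₁ → ℝ) (q : 𝒮 → ℝ) :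
    C.errIID W q = (M : ℝ)⁻¹ * ∑ m, ∑ y : Fin n → 𝒴, ∑ y1 : Fin n → 𝒴₁,
      if C.g (y, C.f1 y1) = m then 0 else ∏ i, pairChan W q (C.f m i) (y i, y1 i) := by
  unfold PCode.errIID PCode.errGiven
  simp only [mul_left_comm _ (M : ℝ)⁻¹, ← Finset.mul_sum]
  congr 1
  simp only [Finset.mul_sum]
  rw [Finset.sum_comm]
  refine Finset.sum_congr rfl fun m _ => ?_
  rw [Finset.sum_comm]
  refine Finset.sum_congr rfl fun y _ => ?_
  rw [Finset.sum_comm]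
  refine Finset.sum_congr rfl fun y1 _ => ?_
  split_ifs
  · simp
  · simp only [← Finset.prod_mul_distrib]
    exact sum_prod_pi fun i s => q s * W (C.f m i) s (y i, y1 i)

lemma sum_pi_prod (F : (Fin n → 𝒴) → (Fin n → 𝒴₁) → ℝ) :
    ∑ z : Fin n → 𝒴 × 𝒴₁, F (fun i => (z i).1) (fun i => (z i).2) = ∑ y, ∑ y1, F y y1 := by
  rw [← Fintype.sum_prod_type']
  exact Fintype.sum_equiv (Equiv.arrowProdEquivProdArrow _ _ _) _ _ fun z => rfl

lemma sum_prod_pairChan (W : 𝒳 → 𝒮 → 𝒴 × 𝒴₁ → ℝ) (q : 𝒮 → ℝ) (x : Fin n → 𝒳) (y : Fin n → 𝒴) :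
    ∑ y1 : Fin n → 𝒴₁, ∏ i, pairChan W q (x i) (y i, y1 i) = ∏ i, outChan W q (x i) (y i) := by
  rw [sum_prod_pi fun i y1 => pairChan W q (x i) (y i, y1)]
  exact Finset.prod_congr rfl fun i _ => (outChan_eq_sum_pairChan W q _ _).symm

lemma one_sub_errIID (hW : IsChannel W) {q : 𝒮 → ℝ} (hq : IsPMF q) (hM : 0 < M)
    (C : PCode 𝒳 𝒴 𝒴₁ n M L) :
    1 - C.errIID W q = (M : ℝ)⁻¹ * ∑ m, ∑ y : Fin n → 𝒴, ∑ y1 : Fin n → 𝒴₁,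
      if C.g (y, C.f1 y1) = m then ∏ i, pairChan W q (C.f m i) (y i, y1 i) else 0 := by
  have hMR : (0 : ℝ) < M := by exact_mod_cast hM
  have h1 : ∀ m, ∑ y : Fin n → 𝒴, ∑ y1 : Fin n → 𝒴₁,
      ∏ i, pairChan W q (C.f m i) (y i, y1 i) = 1 := by
    intro m
    simp only [sum_prod_pairChan]
    rw [sum_prod_pi fun i y => outChan W q (C.f m i) y]
    simp [(isPMF_outChan hW hq _).2]
  have h2 : (M : ℝ)⁻¹ * ∑ m : Fin M, ∑ y : Fin n → 𝒴, ∑ y1 : Fin n → 𝒴₁,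
      ∏ i, pairChan W q (C.f m i) (y i, y1 i) = 1 := by
    simp [h1, hMR.ne']
  rw [errIID_eq, ← h2, ← mul_sub]
  simp only [← Finset.sum_sub_distrib]
  congr 1
  refine Finset.sum_congr rfl fun m _ => Finset.sum_congr rfl fun y _ =>
    Finset.sum_congr rfl fun y1 _ => ?_
  split_ifs <;> simp

lemma success_le_pair [DecidableEq 𝒳] (hW : IsChannel W) {q : 𝒮 → ℝ} (hq : IsPMF q) (hn : 0 < n)
    (hM : 0 < M) (C : PCode 𝒳 𝒴 𝒴₁ n M L) :
    (1 - C.errIID W q) * Real.log M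
      ≤ n * chanInfo (inputType C.f) (pairChan W q) + Real.log 2 := by
  have h := log_mul_success_le hn hM C.f (fun x => isPMF_pairChan hW hq x)
    (fun m z => C.g (fun i => (z i).1, C.f1 fun i => (z i).2) = m) (L := 1)
    (fun z => Finset.card_le_one.2 fun a ha b hb => by
      rw [Finset.mem_filter] at ha hb
      exact ha.2.symm.trans hb.2)
  rw [one_sub_errIID hW hq hM C]
  convert h using 3
  · congr 1
    funext m
    exact (sum_pi_prod fun y y1 => if C.g (y, C.f1 y1) = m then
      ∏ i, pairChan W q (C.f m i) (y i, y1 i) else 0).symm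
  · norm_num

lemma success_le_out [DecidableEq 𝒳] (hW : IsChannel W) {q : 𝒮 → ℝ} (hq : IsPMF q) (hn : 0 < n)
    (hM : 0 < M) (C : PCode 𝒳 𝒴 𝒴₁ n M L) :
    (1 - C.errIID W q) * Real.log M
      ≤ n * chanInfo (inputType C.f) (outChan W q) + Real.log (1 + L) := by
  classical
  have h := log_mul_success_le hn hM C.f (fun x => isPMF_outChan hW hq x)
    (fun m y => ∃ l, C.g (y, l) = m) (L := L)
    (fun y => by
      refine (Finset.card_le_card (t := Finset.univ.image fun l : Fin L => C.g (y, l)) ?_).trans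
        (Finset.card_image_le.trans (by simp))
      intro m hm
      obtain ⟨l, hl⟩ := (Finset.mem_filter.1 hm).2
      exact Finset.mem_image.2 ⟨l, Finset.mem_univ _, hl⟩)
  refine le_trans (mul_le_mul_of_nonneg_right ?_ (Real.log_natCast_nonneg M)) h
  rw [one_sub_errIID hW hq hM C]
  refine mul_le_mul_of_nonneg_left (Finset.sum_le_sum fun m _ => Finset.sum_le_sum fun y _ => ?_)
    (by positivity)
  have hnn : ∀ y1 : Fin n → 𝒴₁, 0 ≤ ∏ i, pairChan W q (C.f m i) (y i, y1 i) := fun y1 =>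
    Finset.prod_nonneg fun i _ => (isPMF_pairChan hW hq _).1 _
  split_ifs with hl
  · rw [← sum_prod_pairChan]
    refine Finset.sum_le_sum fun y1 _ => ?_
    split_ifs
    exacts [le_rfl, hnn y1]
  · refine (Finset.sum_eq_zero fun y1 _ => if_neg fun h => hl ⟨_, h⟩).le

lemma CompAchievable.le_RCS [Nonempty 𝒳] (hW : IsChannel W) (hQ : ∀ q ∈ Q, IsPMF q)
    (hQne : Q.Nonempty) {R : ℝ} (hR : CompAchievable W C1 Q R) : R ≤ RCS W C1 Q := by
  classical
  refine le_csInf (nonempty_values hQne _) ?_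
  rintro _ ⟨q, hq, rfl⟩
  set S := sSup {v | ∃ p : 𝒳 → ℝ, IsPMF p ∧ v = min (IqXY W p q + C1) (IqXYY1 W p q)} with hS
  have hl2 : 0 < Real.log 2 := Real.log_pos one_lt_two
  have key : ∀ k : ℕ, R ≤ S + (1 + R) * (1 / ((k : ℝ) + 1)) := by
    intro k
    obtain ⟨N, hN⟩ := hR (1 / ((k : ℝ) + 1)) (by positivity)
    obtain ⟨n, hNn, hkn⟩ : ∃ n, N ≤ n ∧ k + 1 ≤ n := ⟨_, le_max_left _ _, le_max_right _ _⟩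
    obtain ⟨M, L, C, hM, ⟨hL1, hL⟩, herr⟩ := hN n hNn
    have hn0 : 0 < n := by omega
    have hnR : (0 : ℝ) < n := by exact_mod_cast hn0
    have hMR : (0 : ℝ) < M := lt_of_lt_of_le (by positivity) hM
    have hM0 : 0 < M := by exact_mod_cast hMR
    have hlogM : n * R * Real.log 2 ≤ Real.log M := by
      have := Real.log_le_log (by positivity) hM
      rwa [Real.log_rpow two_pos] at this
    have hlogL : Real.log (1 + L) ≤ Real.log 2 + n * C1 * Real.log 2 := by
      rw [← Real.log_rpow two_pos, ← Real.log_mul two_ne_zero (by positivity)]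
      refine Real.log_le_log (by positivity) ?_
      have : (1 : ℝ) ≤ L := by exact_mod_cast hL1
      linarith
    have he1 : 1 / ((k : ℝ) + 1) ≤ 1 := by
      rw [div_le_one (by positivity)]
      linarith [Nat.cast_nonneg (α := ℝ) k]
    have hlow : (1 - 1 / ((k : ℝ) + 1)) * (n * R * Real.log 2)
        ≤ (1 - C.errIID W q) * Real.log M :=
      (mul_le_mul_of_nonneg_left hlogM (by linarith)).trans
        (mul_le_mul_of_nonneg_right (by linarith [herr q hq]) (Real.log_natCast_nonneg M))
    have hp := isPMF_inputType hn0 hM0 C.f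
    have hval : (1 - 1 / ((k : ℝ) + 1)) * R - 1 / n
        ≤ min (IqXY W (inputType C.f) q + C1) (IqXYY1 W (inputType C.f) q) := by
      rw [IqXY_eq hW (hQ q hq), IqXYY1_eq hW (hQ q hq)]
      have h1 := success_le_out hW (hQ q hq) hn0 hM0 C
      have h2 := success_le_pair hW (hQ q hq) hn0 hM0 C
      have hrw : (1 - 1 / ((k : ℝ) + 1)) * R - 1 / n
          = ((1 - 1 / ((k : ℝ) + 1)) * (n * R * Real.log 2) - Real.log 2) / n / Real.log 2 := by
        field_simp
      rw [hrw]
      refine le_min ?_ ?_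
      · rw [← sub_le_iff_le_add, div_sub' hl2.ne', div_le_div_iff_of_pos_right hl2, sub_le_iff_le_add,
          div_le_iff₀ hnR]
        linarith
      · rw [div_le_div_iff_of_pos_right hl2, div_le_iff₀ hnR]
        linarith
    have hle := hval.trans (le_csSup (bddAbove_cutset W C1 q) ⟨_, hp, rfl⟩)
    have hnk : 1 / (n : ℝ) ≤ 1 / ((k : ℝ) + 1) :=
      one_div_le_one_div_of_le (by positivity) (by exact_mod_cast hkn)
    rw [← hS] at hle
    linarith
  have hlim := (tendsto_one_div_add_atTop_nhds_zero_nat (𝕜 := ℝ)).const_mul (1 + R) |>.const_add S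
  rw [mul_zero, add_zero] at hlim
  exact ge_of_tendsto' hlim key

end CodeConverse

section RandomCoding

variable {α ζ : Type} [Fintype α] [Fintype ζ] {n M : ℕ}

lemma sum_prod_pi_mul_mul {k : ℕ} (u : ζ → ℝ) (hu : ∑ z, u z = 1) {i j : Fin k} (hij : i ≠ j)
    (g h : ζ → ℝ) :
    ∑ z : Fin k → ζ, (∏ l, u (z l)) * (g (z i) * h (z j))
      = (∑ z, u z * g z) * ∑ z, u z * h z := by
  classical
  have key : ∀ z : Fin k → ζ, (∏ l, u (z l)) * (g (z i) * h (z j))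
      = ∏ l, u (z l) * ((if l = i then g (z l) else 1) * (if l = j then h (z l) else 1)) := by
    intro z
    simp only [Finset.prod_mul_distrib, Finset.prod_ite_eq', Finset.mem_univ, if_true]
  simp only [key]
  rw [sum_prod_pi fun l z => u z * ((if l = i then g z else 1) * (if l = j then h z else 1)),
    ← Finset.mul_prod_erase _ _ (Finset.mem_univ i),
    ← Finset.mul_prod_erase _ _ (Finset.mem_erase.2 ⟨hij.symm, Finset.mem_univ j⟩),
    Finset.prod_eq_one]
  · simp [hij, hij.symm]
  · intro l hl
    simp only [Finset.mem_erase] at hl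
    simp [hl.1, hl.2.1, hu]

/-- The probability of a codebook whose letters are drawn independently from `p`. -/
def bookProb (p : α → ℝ) (c : Fin M → Fin n → α) : ℝ := ∏ m, ∏ i, p (c m i)

lemma bookProb_nonneg {p : α → ℝ} (hp : IsPMF p) (c : Fin M → Fin n → α) : 0 ≤ bookProb p c :=
  Finset.prod_nonneg fun _ _ => Finset.prod_nonneg fun _ _ => hp.1 _

lemma sum_wordProb {p : α → ℝ} (hp : IsPMF p) : ∑ x : Fin n → α, ∏ i, p (x i) = 1 := by
  rw [sum_prod_pi fun _ x => p x]
  simp [hp.2]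

lemma sum_bookProb {p : α → ℝ} (hp : IsPMF p) : ∑ c : Fin M → Fin n → α, bookProb p c = 1 := by
  unfold bookProb
  rw [sum_prod_pi fun _ (x : Fin n → α) => ∏ i, p (x i)]
  simp [sum_wordProb hp]

/-- The other messages of the bin containing `m`. -/
def rivals {β : Type} [DecidableEq β] (bin : Fin M → β) (m : Fin M) : Finset (Fin M) :=
  Finset.univ.filter fun m' => m' ≠ m ∧ bin m' = bin m

/-- An upper bound on the error probability of maximum-score decoding within a bin: `a` penalises
a low score of the sent word and `b` a high score of a rival word. -/
def testErr {β : Type} [DecidableEq β] (K a b : α → ζ → ℝ) (bin : Fin M → β)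
    (c : Fin M → Fin n → α) : ℝ :=
  (M : ℝ)⁻¹ * ∑ m, ∑ z : Fin n → ζ, (∏ i, K (c m i) (z i)) *
    (∏ i, a (c m i) (z i) + ∑ m' ∈ rivals bin m, ∏ i, b (c m' i) (z i))

lemma testErr_mono {β : Type} [DecidableEq β] {K K' a b : α → ζ → ℝ} (hK : ∀ x z, 0 ≤ K x z)
    (hKK : ∀ x z, K x z ≤ K' x z) (ha : ∀ x z, 0 ≤ a x z) (hb : ∀ x z, 0 ≤ b x z)
    (bin : Fin M → β) (c : Fin M → Fin n → α) : testErr K a b bin c ≤ testErr K' a b bin c := by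
  unfold testErr
  gcongr with m _ z _
  · exact add_nonneg (Finset.prod_nonneg fun _ _ => ha _ _)
      (Finset.sum_nonneg fun _ _ => Finset.prod_nonneg fun _ _ => hb _ _)
  · exact fun _ _ => hK _ _
  · exact hKK _ _

lemma testErr_nonneg {β : Type} [DecidableEq β] {K a b : α → ζ → ℝ} (hK : ∀ x z, 0 ≤ K x z)
    (ha : ∀ x z, 0 ≤ a x z) (hb : ∀ x z, 0 ≤ b x z)
    (bin : Fin M → β) (c : Fin M → Fin n → α) : 0 ≤ testErr K a b bin c :=
  mul_nonneg (by positivity) (Finset.sum_nonneg fun _ _ => Finset.sum_nonneg fun _ _ =>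
    mul_nonneg (Finset.prod_nonneg fun _ _ => hK _ _)
      (add_nonneg (Finset.prod_nonneg fun _ _ => ha _ _)
        (Finset.sum_nonneg fun _ _ => Finset.prod_nonneg fun _ _ => hb _ _)))

lemma expect_sent {p : α → ℝ} (hp : IsPMF p) (K a : α → ζ → ℝ) (m : Fin M) :
    ∑ c : Fin M → Fin n → α, bookProb p c *
        ∑ z : Fin n → ζ, (∏ i, K (c m i) (z i)) * ∏ i, a (c m i) (z i)
      = (∑ x, p x * ∑ z, K x z * a x z) ^ n := by
  have h1 : ∀ x : Fin n → α, ∑ z : Fin n → ζ, (∏ i, K (x i) (z i)) * ∏ i, a (x i) (z i)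
      = ∏ i, ∑ z, K (x i) z * a (x i) z := by
    intro x
    simp only [← Finset.prod_mul_distrib]
    exact sum_prod_pi fun i z => K (x i) z * a (x i) z
  simp only [h1, bookProb]
  rw [sum_prod_pi_mul (fun _ (x : Fin n → α) => ∏ i, p (x i)) (fun _ => sum_wordProb hp) m
    fun x => ∏ i, ∑ z, K (x i) z * a (x i) z]
  simp only [← Finset.prod_mul_distrib]
  rw [sum_prod_pi fun _ x => p x * ∑ z, K x z * a x z]
  simp

lemma expect_rival {p : α → ℝ} (hp : IsPMF p) (K b : α → ζ → ℝ) {m m' : Fin M} (hm : m ≠ m') :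
    ∑ c : Fin M → Fin n → α, bookProb p c *
        ∑ z : Fin n → ζ, (∏ i, K (c m i) (z i)) * ∏ i, b (c m' i) (z i)
      = (∑ z, (∑ x, p x * K x z) * ∑ x, p x * b x z) ^ n := by
  simp only [Finset.mul_sum (Finset.univ : Finset (Fin n → ζ))]
  rw [Finset.sum_comm]
  have h1 : ∀ z : Fin n → ζ, ∑ c : Fin M → Fin n → α, bookProb p c *
      ((∏ i, K (c m i) (z i)) * ∏ i, b (c m' i) (z i))
      = ∏ i, (∑ x, p x * K x (z i)) * ∑ x, p x * b x (z i) := by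
    intro z
    unfold bookProb
    rw [sum_prod_pi_mul_mul (fun x : Fin n → α => ∏ i, p (x i)) (sum_wordProb hp) hm
      (fun x => ∏ i, K (x i) (z i)) (fun x => ∏ i, b (x i) (z i))]
    simp only [← Finset.prod_mul_distrib]
    rw [sum_prod_pi fun i x => p x * K x (z i), sum_prod_pi fun i x => p x * b x (z i),
      Finset.prod_mul_distrib]
  simp only [h1]
  rw [sum_prod_pi fun _ z => (∑ x, p x * K x z) * ∑ x, p x * b x z]
  simp

lemma expect_testErr_le {β : Type} [DecidableEq β] {p : α → ℝ} (hp : IsPMF p)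
    {K a b : α → ζ → ℝ} (hK : ∀ x z, 0 ≤ K x z) (hb : ∀ x z, 0 ≤ b x z)
    (hM : 0 < M) (bin : Fin M → β) {N : ℝ} (hN : ∀ m, ((rivals bin m).card : ℝ) ≤ N) :
    ∑ c : Fin M → Fin n → α, bookProb p c * testErr K a b bin c
      ≤ (∑ x, p x * ∑ z, K x z * a x z) ^ n
        + N * (∑ z, (∑ x, p x * K x z) * ∑ x, p x * b x z) ^ n := by
  set A := ∑ x, p x * ∑ z, K x z * a x z
  set B := ∑ z, (∑ x, p x * K x z) * ∑ x, p x * b x z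
  have hB : 0 ≤ B := Finset.sum_nonneg fun z _ => mul_nonneg
    (Finset.sum_nonneg fun x _ => mul_nonneg (hp.1 x) (hK x z))
    (Finset.sum_nonneg fun x _ => mul_nonneg (hp.1 x) (hb x z))
  have hMR : (0 : ℝ) < M := by exact_mod_cast hM
  have h1 : ∑ c : Fin M → Fin n → α, bookProb p c * testErr K a b bin c
      = (M : ℝ)⁻¹ * ∑ m : Fin M, (A ^ n + (rivals bin m).card * B ^ n) := by
    simp only [testErr, mul_left_comm _ (M : ℝ)⁻¹, ← Finset.mul_sum]
    congr 1
    simp only [Finset.mul_sum (Finset.univ : Finset (Fin M))]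
    rw [Finset.sum_comm]
    refine Finset.sum_congr rfl fun m _ => ?_
    simp only [mul_add, Finset.sum_add_distrib]
    rw [expect_sent hp K a m]
    congr 1
    simp only [Finset.mul_sum (rivals bin m)]
    have h2 : ∀ c : Fin M → Fin n → α, bookProb p c * ∑ z : Fin n → ζ, ∑ m' ∈ rivals bin m,
        (∏ i, K (c m i) (z i)) * ∏ i, b (c m' i) (z i)
        = ∑ m' ∈ rivals bin m, bookProb p c * ∑ z : Fin n → ζ,
          (∏ i, K (c m i) (z i)) * ∏ i, b (c m' i) (z i) := by
      intro c
      rw [Finset.sum_comm, Finset.mul_sum]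
    simp only [h2]
    rw [Finset.sum_comm, Finset.sum_congr rfl fun m' hm' =>
      expect_rival hp K b (Finset.mem_filter.1 hm').2.1.symm]
    simp [B]
  rw [h1, inv_mul_le_iff₀ hMR]
  calc ∑ m : Fin M, (A ^ n + (rivals bin m).card * B ^ n)
      ≤ ∑ _m : Fin M, (A ^ n + N * B ^ n) := by
        gcongr with m
        exact hN m
    _ = _ := by simp [mul_add]

lemma exists_book_le [Nonempty α] {p : α → ℝ} (hp : IsPMF p) (G : (Fin M → Fin n → α) → ℝ) {ε : ℝ}
    (hG : ∑ c, bookProb p c * G c ≤ ε) : ∃ c, G c ≤ ε := by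
  obtain ⟨c, hc⟩ := Finite.exists_min G
  refine ⟨c, le_trans ?_ hG⟩
  calc G c = ∑ c', bookProb p c' * G c := by rw [← Finset.sum_mul, sum_bookProb hp, one_mul]
    _ ≤ _ := Finset.sum_le_sum fun d _ => mul_le_mul_of_nonneg_left (hc d) (bookProb_nonneg hp d)

/-- Maximum-score decoding within a bin. -/
lemma exists_decoder {β Z : Type} [DecidableEq β] (hM : 0 < M) (F : Fin M → Z → ℝ)
    (bin : Fin M → β) :
    ∃ g : Z × β → Fin M, ∀ z m, bin (g (z, bin m)) = bin m ∧ F m z ≤ F (g (z, bin m)) z := by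
  have : ∀ zl : Z × β, ∃ k, ∀ m, bin m = zl.2 → bin k = zl.2 ∧ F m zl.1 ≤ F k zl.1 := by
    intro ⟨z, l⟩
    rcases (Finset.univ.filter fun m => bin m = l).eq_empty_or_nonempty with h | h
    · exact ⟨⟨0, hM⟩, fun m hm =>
        absurd hm (Finset.filter_eq_empty_iff.1 h (Finset.mem_univ m))⟩
    · obtain ⟨k, hk, hmax⟩ := Finset.exists_max_image _ (fun m => F m z) h
      exact ⟨k, fun m hm => ⟨(Finset.mem_filter.1 hk).2,
        hmax m (Finset.mem_filter.2 ⟨Finset.mem_univ m, hm⟩)⟩⟩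
  choose g hg using this
  exact ⟨g, fun z m => hg (z, bin m) m rfl⟩

/-- A decoding error forces one of the two exponential tests to fire. -/
lemma one_le_test {β : Type} [DecidableEq β] (f : α → ζ → ℝ) (γ : ℝ) {s : ℝ} (hs : 0 ≤ s)
    (bin : Fin M → β) (c : Fin M → Fin n → α) (z : Fin n → ζ) {m k : Fin M} (hk : k ≠ m)
    (hbin : bin k = bin m) (hF : ∑ i, f (c m i) (z i) ≤ ∑ i, f (c k i) (z i)) :
    1 ≤ ∏ i, Real.exp (-s * (f (c m i) (z i) - γ))
      + ∑ m' ∈ rivals bin m, ∏ i, Real.exp (f (c m' i) (z i) - γ) := by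
  simp only [← Real.exp_sum, ← Finset.mul_sum, Finset.sum_sub_distrib, Finset.sum_const,
    Finset.card_univ, Fintype.card_fin, nsmul_eq_mul]
  rcases le_total (∑ i, f (c m i) (z i)) (n * γ) with h | h
  · refine le_add_of_le_of_nonneg (Real.one_le_exp ?_) (Finset.sum_nonneg fun _ _ => by positivity)
    nlinarith
  · refine le_add_of_nonneg_of_le (by positivity) ?_
    refine le_trans (Real.one_le_exp (x := ∑ i, f (c k i) (z i) - n * γ) (by linarith)) ?_
    exact Finset.single_le_sum (f := fun m' => Real.exp (∑ i, f (c m' i) (z i) - n * γ))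
      (fun _ _ => by positivity) (Finset.mem_filter.2 ⟨Finset.mem_univ k, hk, hbin⟩)

/-- Scores with positive mean have a uniformly small exponential moment. -/
lemma exists_chernoff {p : α → ℝ} (hp : IsPMF p) (E : ℝ) (hE : 0 ≤ E) {τ : ℝ} (hτ : 0 < τ) :
    ∃ s > 0, ∃ ρ < 1, ∀ K : α → ζ → ℝ, (∀ x, IsPMF (K x)) → ∀ h : α → ζ → ℝ,
      (∀ x z, |h x z| ≤ E) → τ ≤ ∑ x, p x * ∑ z, K x z * h x z →
      ∑ x, p x * ∑ z, K x z * Real.exp (-s * h x z) ≤ ρ := by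
  set s := min (1 / (E + 1)) (τ / (2 * (E + 1) ^ 2)) with hs
  have hE1 : 0 < E + 1 := by linarith
  have hs0 : 0 < s := lt_min (by positivity) (by positivity)
  have hs1 : s * (E + 1) ≤ 1 := by
    rw [← le_div_iff₀ hE1]; exact min_le_left _ _
  have hs2 : s * (2 * (E + 1) ^ 2) ≤ τ := by
    rw [← le_div_iff₀ (by positivity)]; exact min_le_right _ _
  refine ⟨s, hs0, 1 - s * τ / 2, by nlinarith [mul_pos hs0 hτ], fun K hK h hh hmean => ?_⟩
  have hpt : ∀ x z, Real.exp (-s * h x z) ≤ 1 + s ^ 2 * (E + 1) ^ 2 - s * h x z := by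
    intro x z
    have h1 : |(-s * h x z)| ≤ s * (E + 1) := by
      rw [abs_mul, abs_neg, abs_of_pos hs0]
      exact mul_le_mul_of_nonneg_left ((hh x z).trans (by linarith)) hs0.le
    have h2 := (abs_le.1 (Real.abs_exp_sub_one_sub_id_le (h1.trans hs1))).2
    have h3 : (-s * h x z) ^ 2 ≤ (s * (E + 1)) ^ 2 := sq_le_sq' (by linarith [abs_le.1 h1])
      (abs_le.1 h1).2
    nlinarith
  calc ∑ x, p x * ∑ z, K x z * Real.exp (-s * h x z)
      ≤ ∑ x, p x * ∑ z, K x z * (1 + s ^ 2 * (E + 1) ^ 2 - s * h x z) :=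
        Finset.sum_le_sum fun x _ => mul_le_mul_of_nonneg_left (Finset.sum_le_sum fun z _ =>
          mul_le_mul_of_nonneg_left (hpt x z) ((hK x).1 z)) (hp.1 x)
    _ = (1 + s ^ 2 * (E + 1) ^ 2) - s * ∑ x, p x * ∑ z, K x z * h x z := by
        simp only [mul_sub, Finset.sum_sub_distrib, ← Finset.sum_mul, (hK _).2, one_mul, hp.2]
        simp only [mul_left_comm _ s, ← Finset.mul_sum]
    _ ≤ 1 - s * τ / 2 := by nlinarith [mul_le_mul_of_nonneg_left hmean hs0.le,
        mul_le_mul_of_nonneg_left hs2 hs0.le]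

lemma rival_moment_le {p : α → ℝ} (hp : IsPMF p) {K f : α → ζ → ℝ} (hK : ∀ x z, 0 ≤ K x z)
    (hf : ∀ z, ∑ x, p x * Real.exp (f x z) ≤ 1) (γ : ℝ) :
    ∑ z, (∑ x, p x * K x z) * ∑ x, p x * Real.exp (f x z - γ)
      ≤ (∑ x, p x * ∑ z, K x z) * Real.exp (-γ) := by
  have h1 : ∀ z, ∑ x, p x * Real.exp (f x z - γ) ≤ Real.exp (-γ) := by
    intro z
    simp only [sub_eq_add_neg, Real.exp_add, ← mul_assoc, ← Finset.sum_mul]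
    exact mul_le_of_le_one_left (by positivity) (hf z)
  refine (Finset.sum_le_sum fun z _ => mul_le_mul_of_nonneg_left (h1 z)
    (Finset.sum_nonneg fun x _ => mul_nonneg (hp.1 x) (hK x z))).trans (le_of_eq ?_)
  rw [← Finset.sum_mul, Finset.sum_comm]
  simp only [Finset.mul_sum]

end RandomCoding

section Achievability

variable {𝒳 𝒮 𝒴 𝒴₁ : Type} [Fintype 𝒳] [Fintype 𝒮] [Fintype 𝒴] [Fintype 𝒴₁]
  {W : 𝒳 → 𝒮 → 𝒴 × 𝒴₁ → ℝ} {W1 : 𝒳 → 𝒴₁ → ℝ} {V : 𝒴₁ → 𝒮 → 𝒴 → ℝ} {C1 : ℝ} {Q : Set (𝒮 → ℝ)}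
  {n M L : ℕ}

/-- Binning the relay's decoded message gives a code whose error is bounded by the two tests. -/
lemma exists_code_errIID_le (hW : IsChannel W) (hV : ∀ y1 s, IsPMF (V y1 s))
    (hfact : ∀ x s y y1, W x s (y, y1) = W1 x y1 * V y1 s y) (hM : 0 < M)
    (bin : Fin M → Fin L) (c : Fin M → Fin n → 𝒳) (f : 𝒳 → 𝒴 → ℝ) (f1 : 𝒳 → 𝒴₁ → ℝ) (γ γ1 : ℝ)
    {s s1 : ℝ} (hs : 0 ≤ s) (hs1 : 0 ≤ s1) :
    ∃ C : PCode 𝒳 𝒴 𝒴₁ n M L, ∀ q, IsPMF q → C.errIID W q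
      ≤ testErr W1 (fun x y1 => Real.exp (-s1 * (f1 x y1 - γ1)))
          (fun x y1 => Real.exp (f1 x y1 - γ1)) (fun _ => ()) c
        + testErr (outChan W q) (fun x y => Real.exp (-s * (f x y - γ)))
          (fun x y => Real.exp (f x y - γ)) bin c := by
  obtain ⟨g1, hg1⟩ := exists_decoder hM (fun m (y1 : Fin n → 𝒴₁) => ∑ i, f1 (c m i) (y1 i))
    (fun _ => ())
  obtain ⟨g, hg⟩ := exists_decoder hM (fun m (y : Fin n → 𝒴) => ∑ i, f (c m i) (y i)) bin
  refine ⟨⟨c, fun y1 => bin (g1 (y1, ())), g⟩, fun q hq => ?_⟩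
  rw [errIID_eq]
  unfold testErr
  rw [← mul_add, ← Finset.sum_add_distrib]
  refine mul_le_mul_of_nonneg_left (Finset.sum_le_sum fun m _ => ?_) (by positivity)
  set T1 : (Fin n → 𝒴₁) → ℝ := fun y1 => ∏ i, Real.exp (-s1 * (f1 (c m i) (y1 i) - γ1))
    + ∑ m' ∈ rivals (fun _ => ()) m, ∏ i, Real.exp (f1 (c m' i) (y1 i) - γ1) with hT1
  set T : (Fin n → 𝒴) → ℝ := fun y => ∏ i, Real.exp (-s * (f (c m i) (y i) - γ))
    + ∑ m' ∈ rivals bin m, ∏ i, Real.exp (f (c m' i) (y i) - γ) with hT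
  have hT10 : ∀ y1, 0 ≤ T1 y1 := fun y1 => by positivity
  have hT0 : ∀ y, 0 ≤ T y := fun y => by positivity
  have hP0 : ∀ (y : Fin n → 𝒴) (y1 : Fin n → 𝒴₁), 0 ≤ ∏ i, pairChan W q (c m i) (y i, y1 i) :=
    fun y y1 => Finset.prod_nonneg fun i _ => (isPMF_pairChan hW hq _).1 _
  have hpt : ∀ (y : Fin n → 𝒴) (y1 : Fin n → 𝒴₁),
      (if g (y, bin (g1 (y1, ()))) = m then 0 else ∏ i, pairChan W q (c m i) (y i, y1 i))
      ≤ (∏ i, pairChan W q (c m i) (y i, y1 i)) * T1 y1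
        + (∏ i, pairChan W q (c m i) (y i, y1 i)) * T y := by
    intro y y1
    rw [← mul_add]
    have hT' := add_nonneg (hT10 y1) (hT0 y)
    split_ifs with h
    · exact mul_nonneg (hP0 y y1) hT'
    refine le_mul_of_one_le_right (hP0 y y1) ?_
    by_cases h1 : g1 (y1, ()) = m
    · rw [h1] at h
      exact le_add_of_nonneg_of_le (hT10 y1)
        (one_le_test f γ hs bin c y h (hg y m).1 (hg y m).2)
    · exact le_add_of_le_of_nonneg
        (one_le_test f1 γ1 hs1 (fun _ => ()) c y1 h1 rfl (hg1 y1 m).2) (hT0 y)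
  refine (Finset.sum_le_sum fun y _ => Finset.sum_le_sum fun y1 _ => hpt y y1).trans (le_of_eq ?_)
  simp only [Finset.sum_add_distrib, ← Finset.sum_mul, sum_prod_pairChan]
  congr 1
  rw [Finset.sum_comm]
  refine Finset.sum_congr rfl fun y1 _ => ?_
  rw [← Finset.sum_mul, sum_prod_pi fun i y => pairChan W q (c m i) (y, y1 i)]
  simp only [sum_pairChan_fst hfact hV hq, hT1]

lemma exists_net (hQcomp : IsCompact Q) {η : ℝ} (hη : 0 < η) :
    ∃ t : Finset (𝒮 → ℝ), (∀ q ∈ t, q ∈ Q) ∧ ∀ q ∈ Q, ∃ q' ∈ t, ∀ s, q s ≤ q' s + η := by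
  obtain ⟨t, htQ, htf, hcov⟩ := hQcomp.finite_cover_balls hη
  refine ⟨htf.toFinset, fun q hq => htQ (htf.mem_toFinset.1 hq), fun q hq => ?_⟩
  obtain ⟨q', hq', hd⟩ := Set.mem_iUnion₂.1 (hcov hq)
  refine ⟨q', htf.mem_toFinset.2 hq', fun s => ?_⟩
  have h1 := (dist_le_pi_dist q q' s).trans_lt hd
  rw [Real.dist_eq] at h1
  linarith [(abs_lt.1 h1).2]

lemma card_rivals_mod_le (hL : 0 < L) (m : Fin M) :
    (rivals (fun m : Fin M => (⟨m % L, Nat.mod_lt _ hL⟩ : Fin L)) m).card ≤ (M - 1) / L := by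
  have h : (insert m (rivals (fun m : Fin M => (⟨m % L, Nat.mod_lt _ hL⟩ : Fin L)) m)).card
      ≤ (Finset.range ((M - 1) / L + 1)).card := by
    refine Finset.card_le_card_of_injOn (fun k => (k : ℕ) / L) (fun k _ => ?_) ?_
    · simp only [Finset.coe_range, Set.mem_Iio]
      exact Nat.lt_succ_of_le (Nat.div_le_div_right (by omega))
    · have hmod : ∀ k ∈ insert m (rivals (fun m : Fin M =>
          (⟨m % L, Nat.mod_lt _ hL⟩ : Fin L)) m), (k : ℕ) % L = m % L := by
        intro k hk
        rcases Finset.mem_insert.1 hk with rfl | hk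
        · rfl
        · exact Fin.mk.inj_iff.1 (Finset.mem_filter.1 hk).2.2
      intro k hk k' hk' hdiv
      have h1 := hmod k hk
      have h2 := hmod k' hk'
      ext
      rw [← Nat.div_add_mod k L, ← Nat.div_add_mod k' L, h1, h2]
      exact congrArg (fun d => L * d + m % L) hdiv
  rw [Finset.card_insert_of_notMem (by simp [rivals]), Finset.card_range] at h
  omega

lemma card_rivals_unit (m : Fin M) : ((rivals (fun _ : Fin M => ()) m).card : ℝ) ≤ (M : ℝ) - 1 := by
  have : rivals (fun _ : Fin M => ()) m = Finset.univ.erase m := by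
    ext k; simp [rivals]
  rw [this, Finset.card_erase_of_mem (Finset.mem_univ m), Nat.cast_sub]
  · simp
  · rw [Finset.card_univ, Fintype.card_fin]
    exact m.pos

lemma two_rpow_nat_mul (n : ℕ) (r : ℝ) :
    (2 : ℝ) ^ ((n : ℝ) * r) = Real.exp (r * Real.log 2) ^ n := by
  rw [Real.rpow_def_of_pos two_pos, ← Real.exp_nat_mul]
  ring_nf

lemma exists_sizes (hC1 : 0 ≤ C1) (R : ℝ) (n : ℕ) :
    ∃ M L : ℕ, 0 < M ∧ (2 : ℝ) ^ ((n : ℝ) * R) ≤ M ∧ LinkOK n L C1 ∧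
      (M : ℝ) - 1 ≤ Real.exp (R * Real.log 2) ^ n ∧
      (((M - 1) / L : ℕ) : ℝ) ≤ 2 * Real.exp ((R - C1) * Real.log 2) ^ n := by
  have hR0 : (0 : ℝ) < 2 ^ ((n : ℝ) * R) := by positivity
  have hx1 : (1 : ℝ) ≤ 2 ^ ((n : ℝ) * C1) := Real.one_le_rpow one_le_two (by positivity)
  have hM0 : 0 < ⌈(2 : ℝ) ^ ((n : ℝ) * R)⌉₊ := Nat.ceil_pos.2 hR0
  have hM1 : (⌈(2 : ℝ) ^ ((n : ℝ) * R)⌉₊ : ℝ) - 1 ≤ Real.exp (R * Real.log 2) ^ n := by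
    rw [← two_rpow_nat_mul]
    linarith [Nat.ceil_lt_add_one hR0.le]
  have hL1 : 1 ≤ ⌊(2 : ℝ) ^ ((n : ℝ) * C1)⌋₊ := (Nat.one_le_floor_iff _).2 hx1
  refine ⟨⌈(2 : ℝ) ^ ((n : ℝ) * R)⌉₊, ⌊(2 : ℝ) ^ ((n : ℝ) * C1)⌋₊, hM0, Nat.le_ceil _,
    ⟨hL1, Nat.floor_le (by positivity)⟩, hM1, ?_⟩
  set M := ⌈(2 : ℝ) ^ ((n : ℝ) * R)⌉₊
  set L := ⌊(2 : ℝ) ^ ((n : ℝ) * C1)⌋₊ with hL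
  have hLR : (1 : ℝ) ≤ L := by exact_mod_cast hL1
  have h2L : Real.exp (C1 * Real.log 2) ^ n ≤ 2 * L := by
    rw [← two_rpow_nat_mul]
    linarith [Nat.lt_floor_add_one ((2 : ℝ) ^ ((n : ℝ) * C1))]
  refine Nat.cast_div_le.trans ?_
  rw [Nat.cast_sub hM0, Nat.cast_one, div_le_iff₀ (by linarith)]
  refine hM1.trans ?_
  have hsplit : Real.exp (R * Real.log 2) ^ n
      = Real.exp ((R - C1) * Real.log 2) ^ n * Real.exp (C1 * Real.log 2) ^ n := by
    rw [← mul_pow, ← Real.exp_add]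
    ring_nf
  rw [hsplit]
  have := mul_le_mul_of_nonneg_left h2L
    (by positivity : 0 ≤ Real.exp ((R - C1) * Real.log 2) ^ n)
  linarith

end Achievability

section CompoundCapacity

variable {𝒳 𝒮 𝒴 𝒴₁ : Type} [Fintype 𝒳] [Fintype 𝒮] [Fintype 𝒴] [Fintype 𝒴₁]
  {W : 𝒳 → 𝒮 → 𝒴 × 𝒴₁ → ℝ} {W1 : 𝒳 → 𝒴₁ → ℝ} {V : 𝒴₁ → 𝒮 → 𝒴 → ℝ} {C1 : ℝ} {Q : Set (𝒮 → ℝ)}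
  {p : 𝒳 → ℝ} {R : ℝ}

lemma sum_shifted_outChan (W : 𝒳 → 𝒮 → 𝒴 × 𝒴₁ → ℝ) (p : 𝒳 → ℝ) (q : 𝒮 → ℝ) (η : ℝ)
    (a : 𝒳 → 𝒴 → ℝ) :
    ∑ x, p x * ∑ y, outChan W (fun s => q s + η) x y * a x y
      = ∑ x, p x * ∑ y, outChan W q x y * a x y
        + η * ∑ x, p x * ∑ y, outChan W (fun _ => 1) x y * a x y := by
  simp only [Finset.mul_sum, ← Finset.sum_add_distrib, outChan, Finset.sum_mul]
  refine Finset.sum_congr rfl fun x _ => Finset.sum_congr rfl fun y _ =>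
    Finset.sum_congr rfl fun s _ => Finset.sum_congr rfl fun y1 _ => by ring

/-- The receiver's tests, robust to enlarging the state pmf by `η` at every state. -/
lemma exists_receiver_test (hW : IsChannel W) (hQ : ∀ q ∈ Q, IsPMF q)
    (hQne : Q.Nonempty) (hQcomp : IsCompact Q) (hQconv : Convex ℝ Q) (hp : IsPMF p)
    {v r : ℝ} (hv : ∀ q ∈ Q, v ≤ chanInfo p (outChan W q)) (hr : r < v) :
    ∃ (f : 𝒳 → 𝒴 → ℝ) (γ s η θ : ℝ), 0 ≤ s ∧ 0 < η ∧ θ < 1 ∧ ∀ q ∈ Q,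
      ∑ x, p x * ∑ y, outChan W (fun s => q s + η) x y * Real.exp (-s * (f x y - γ)) ≤ θ ∧
      Real.exp r * (∑ y, (∑ x, p x * outChan W (fun s => q s + η) x y) *
        ∑ x, p x * Real.exp (f x y - γ)) ≤ θ := by
  set g := (v - r) / 4 with hg
  have hg0 : 0 < g := by rw [hg]; linarith
  obtain ⟨B, hB0, f, hfB, hfexp, hfmean⟩ := exists_universal_score hW hQ hQne hQcomp hQconv hp
    (t := v - g) (fun q hq => by linarith [hv q hq]) hg0
  set γ := v - 3 * g with hγ
  obtain ⟨s, hs0, ρ, hρ1, hρ⟩ := exists_chernoff (ζ := 𝒴) hp (B + |γ|) (by positivity) hg0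
  set κ := ∑ x, p x * ∑ y, outChan W (fun _ => 1) x y * Real.exp (-s * (f x y - γ)) with hκ
  set μ := ∑ x, p x * ∑ y, outChan W (fun _ => 1) x y * (1 : ℝ) with hμ
  have hlim1 : ∀ᶠ η in nhdsWithin (0 : ℝ) (Set.Ioi 0), ρ + η * κ < 1 :=
    ((show Continuous fun η : ℝ => ρ + η * κ by fun_prop).tendsto' 0 ρ (by simp)
      |>.mono_left nhdsWithin_le_nhds).eventually_lt_const hρ1
  have hD : Real.exp (r - γ) < 1 := by
    rw [Real.exp_lt_one_iff]
    linarith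
  have hlim2 : ∀ᶠ η in nhdsWithin (0 : ℝ) (Set.Ioi 0), (1 + η * μ) * Real.exp (r - γ) < 1 :=
    ((show Continuous fun η : ℝ => (1 + η * μ) * Real.exp (r - γ) by fun_prop).tendsto' 0
      (Real.exp (r - γ)) (by simp) |>.mono_left nhdsWithin_le_nhds).eventually_lt_const hD
  obtain ⟨η, ⟨h1, h2⟩, hη⟩ := ((hlim1.and hlim2).and self_mem_nhdsWithin).exists
  refine ⟨f, γ, s, η, max (ρ + η * κ) ((1 + η * μ) * Real.exp (r - γ)), hs0.le, hη,
    max_lt h1 h2, fun q hq => ⟨le_trans ?_ (le_max_left _ _), le_trans ?_ (le_max_right _ _)⟩⟩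
  · rw [sum_shifted_outChan]
    refine add_le_add (hρ _ (isPMF_outChan hW (hQ q hq)) (fun x y => f x y - γ)
      (fun x y => (abs_sub _ _).trans (add_le_add (hfB x y) le_rfl)) ?_) le_rfl
    have hone : ∀ x, ∑ y, outChan W q x y = 1 := fun x => (isPMF_outChan hW (hQ q hq) x).2
    simp only [mul_sub, Finset.sum_sub_distrib, ← Finset.sum_mul, hone, one_mul, hp.2]
    linarith [hfmean q hq]
  · have hKη : ∀ x y, 0 ≤ outChan W (fun s => q s + η) x y := fun x y =>
      Finset.sum_nonneg fun s _ => mul_nonneg (add_nonneg ((hQ q hq).1 s) (le_of_lt hη))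
        (Finset.sum_nonneg fun y1 _ => (hW x s).1 _)
    have hmass := sum_shifted_outChan W p q η fun _ _ => 1
    have hone : ∀ x, ∑ y, outChan W q x y = 1 := fun x => (isPMF_outChan hW (hQ q hq) x).2
    rw [← hμ] at hmass
    simp only [mul_one, hone, hp.2] at hmass
    refine (mul_le_mul_of_nonneg_left (rival_moment_le hp hKη hfexp γ)
      (Real.exp_pos r).le).trans (le_of_eq ?_)
    rw [hmass, sub_eq_add_neg, Real.exp_add]
    ring

lemma exists_relay_test (hW1 : ∀ x, IsPMF (W1 x)) (hp : IsPMF p) {r : ℝ}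
    (hr : r < chanInfo p W1) :
    ∃ (f : 𝒳 → 𝒴₁ → ℝ) (γ s θ : ℝ), 0 ≤ s ∧ θ < 1 ∧
      ∑ x, p x * ∑ y, W1 x y * Real.exp (-s * (f x y - γ)) ≤ θ ∧
      Real.exp r * (∑ y, (∑ x, p x * W1 x y) * ∑ x, p x * Real.exp (f x y - γ)) ≤ θ := by
  set g := (chanInfo p W1 - r) / 3 with hg
  have hg0 : 0 < g := by rw [hg]; linarith
  obtain ⟨B, hB0, hB⟩ := exists_score (ζ := 𝒴₁) hp hg0
  obtain ⟨f, hfB, hfexp, hfmean⟩ := hB W1 hW1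
  set γ := chanInfo p W1 - 2 * g with hγ
  obtain ⟨s, hs0, ρ, hρ1, hρ⟩ := exists_chernoff (ζ := 𝒴₁) hp (B + |γ|) (by positivity) hg0
  refine ⟨f, γ, s, max ρ (Real.exp (r - γ)), hs0.le, max_lt hρ1 ?_, le_trans ?_ (le_max_left _ _),
    le_trans ?_ (le_max_right _ _)⟩
  · rw [Real.exp_lt_one_iff]
    linarith
  · refine hρ W1 hW1 (fun x y => f x y - γ)
      (fun x y => (abs_sub _ _).trans (add_le_add (hfB x y) le_rfl)) ?_
    simp only [mul_sub, Finset.sum_sub_distrib, ← Finset.sum_mul, (hW1 _).2, one_mul, hp.2]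
    linarith
  · refine (mul_le_mul_of_nonneg_left (rival_moment_le hp (fun x => (hW1 x).1) hfexp γ)
      (Real.exp_pos r).le).trans (le_of_eq ?_)
    simp only [(hW1 _).2, mul_one, hp.2, one_mul]
    rw [sub_eq_add_neg, Real.exp_add]

lemma expect_testErr_le_pow {ζ β : Type} [Fintype ζ] [DecidableEq β] {n M : ℕ} (hp : IsPMF p)
    {K a b : 𝒳 → ζ → ℝ} (hK : ∀ x z, 0 ≤ K x z) (ha : ∀ x z, 0 ≤ a x z) (hb : ∀ x z, 0 ≤ b x z)
    (hM : 0 < M) (bin : Fin M → β) {D r θ : ℝ} (hD : 0 ≤ D)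
    (hbin : ∀ m, ((rivals bin m).card : ℝ) ≤ D * Real.exp r ^ n)
    (h1 : ∑ x, p x * ∑ z, K x z * a x z ≤ θ)
    (h2 : Real.exp r * (∑ z, (∑ x, p x * K x z) * ∑ x, p x * b x z) ≤ θ) :
    ∑ c : Fin M → Fin n → 𝒳, bookProb p c * testErr K a b bin c ≤ (1 + D) * θ ^ n := by
  refine (expect_testErr_le hp hK hb hM bin hbin).trans ?_
  rw [mul_assoc, ← mul_pow, add_mul, one_mul]
  refine add_le_add (pow_le_pow_left₀ ?_ h1 n)
    (mul_le_mul_of_nonneg_left (pow_le_pow_left₀ ?_ h2 n) hD)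
  · exact Finset.sum_nonneg fun x _ => mul_nonneg (hp.1 x) (Finset.sum_nonneg fun z _ =>
      mul_nonneg (hK x z) (ha x z))
  · exact mul_nonneg (Real.exp_pos _).le (Finset.sum_nonneg fun z _ => mul_nonneg
      (Finset.sum_nonneg fun x _ => mul_nonneg (hp.1 x) (hK x z))
      (Finset.sum_nonneg fun x _ => mul_nonneg (hp.1 x) (hb x z)))

/-- A single codebook that is good for one test and for each of finitely many further tests. -/
lemma exists_book_testErr_le {ι ζ ζ' β β' : Type} [Fintype ζ] [Fintype ζ'] [DecidableEq β]
    [DecidableEq β'] [Nonempty 𝒳] {n M : ℕ} (hp : IsPMF p) (t : Finset ι)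
    {K1 a1 b1 : 𝒳 → ζ' → ℝ} {bin1 : Fin M → β'} {K : ι → 𝒳 → ζ → ℝ} {a b : 𝒳 → ζ → ℝ}
    {bin : Fin M → β} {A B : ℝ} (hK : ∀ i ∈ t, ∀ x z, 0 ≤ K i x z) (ha : ∀ x z, 0 ≤ a x z)
    (hb : ∀ x z, 0 ≤ b x z)
    (h1 : ∑ c : Fin M → Fin n → 𝒳, bookProb p c * testErr K1 a1 b1 bin1 c ≤ A)
    (h : ∀ i ∈ t, ∑ c : Fin M → Fin n → 𝒳, bookProb p c * testErr (K i) a b bin c ≤ B) :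
    ∃ c : Fin M → Fin n → 𝒳, ∀ i ∈ t,
      testErr K1 a1 b1 bin1 c + testErr (K i) a b bin c ≤ A + t.card * B := by
  obtain ⟨c, hc⟩ := exists_book_le hp
    (fun c : Fin M → Fin n → 𝒳 => testErr K1 a1 b1 bin1 c + ∑ i ∈ t, testErr (K i) a b bin c)
    (ε := A + t.card * B) (by
      have hsum : ∑ c : Fin M → Fin n → 𝒳, bookProb p c * ∑ i ∈ t, testErr (K i) a b bin c
          = ∑ i ∈ t, ∑ c : Fin M → Fin n → 𝒳, bookProb p c * testErr (K i) a b bin c := by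
        rw [Finset.sum_comm]
        exact Finset.sum_congr rfl fun c _ => Finset.mul_sum _ _ _
      rw [Finset.sum_congr rfl fun c _ => mul_add (bookProb p c) _ _, Finset.sum_add_distrib, hsum]
      refine add_le_add h1 ((Finset.sum_le_sum h).trans (le_of_eq ?_))
      rw [Finset.sum_const, nsmul_eq_mul])
  refine ⟨c, fun i hi => (add_le_add le_rfl ?_).trans hc⟩
  exact Finset.single_le_sum (f := fun i => testErr (K i) a b bin c)
    (fun j hj => testErr_nonneg (hK j hj) ha hb bin c) hi

lemma outChan_shift_nonneg (hW : IsChannel W) {q : 𝒮 → ℝ} (hq : ∀ s, 0 ≤ q s) {η : ℝ}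
    (hη : 0 ≤ η) (x : 𝒳) (y : 𝒴) : 0 ≤ outChan W (fun s => q s + η) x y :=
  Finset.sum_nonneg fun s _ => mul_nonneg (add_nonneg (hq s) hη)
    (Finset.sum_nonneg fun _ _ => (hW x s).1 _)

/-- Codes of every block length whose error decays geometrically, uniformly over the state set. -/
lemma exists_codes_of_lt [Nonempty 𝒳] (hW : IsChannel W) (hC1 : 0 ≤ C1)
    (hQ : ∀ q ∈ Q, IsPMF q) (hQne : Q.Nonempty) (hQcomp : IsCompact Q) (hQconv : Convex ℝ Q)
    (hW1 : ∀ x, IsPMF (W1 x)) (hV : ∀ y1 s, IsPMF (V y1 s))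
    (hfact : ∀ x s y y1, W x s (y, y1) = W1 x y1 * V y1 s y) (hp : IsPMF p) {v : ℝ}
    (hv : ∀ q ∈ Q, v ≤ chanInfo p (outChan W q)) (hrv : (R - C1) * Real.log 2 < v)
    (hr1 : R * Real.log 2 < chanInfo p W1) :
    ∃ D θ : ℝ, 0 ≤ θ ∧ θ < 1 ∧ ∀ n : ℕ, ∃ (M L : ℕ) (C : PCode 𝒳 𝒴 𝒴₁ n M L),
      (2 : ℝ) ^ ((n : ℝ) * R) ≤ M ∧ LinkOK n L C1 ∧ ∀ q ∈ Q, C.errIID W q ≤ D * θ ^ n := by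
  obtain ⟨f, γ, s, η, θ, hs, hη, hθ, htest⟩ :=
    exists_receiver_test hW hQ hQne hQcomp hQconv hp hv hrv
  obtain ⟨f1, γ1, s1, θ1, hs1, hθ1, htest1⟩ := exists_relay_test hW1 hp hr1
  obtain ⟨t, htQ, ht⟩ := exists_net hQcomp hη
  obtain ⟨θ', hθ'0, hθ'1, hθθ', hθ1θ'⟩ : ∃ θ' : ℝ, 0 ≤ θ' ∧ θ' < 1 ∧ θ ≤ θ' ∧ θ1 ≤ θ' :=
    ⟨max (max θ θ1) 0, le_max_right _ _, max_lt (max_lt hθ hθ1) one_pos,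
      (le_max_left _ _).trans (le_max_left _ _), (le_max_right _ _).trans (le_max_left _ _)⟩
  refine ⟨1 + 1 + t.card * (1 + 2), θ', hθ'0, hθ'1, fun n => ?_⟩
  obtain ⟨M, L, hM0, hM, hL, hMb, hLb⟩ := exists_sizes hC1 R n
  obtain ⟨bin, hbin⟩ : ∃ bin : Fin M → Fin L, ∀ m, (rivals bin m).card ≤ (M - 1) / L :=
    ⟨_, card_rivals_mod_le hL.1⟩
  have hunit : ∀ m : Fin M, ((rivals (fun _ => ()) m).card : ℝ)
      ≤ 1 * Real.exp (R * Real.log 2) ^ n := fun m =>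
    (card_rivals_unit m).trans (by rwa [one_mul])
  have hmod : ∀ m, ((rivals bin m).card : ℝ) ≤ 2 * Real.exp ((R - C1) * Real.log 2) ^ n :=
    fun m => (Nat.cast_le.2 (hbin m)).trans hLb
  obtain ⟨c, hc⟩ := exists_book_testErr_le (n := n) hp t
    (fun q hq => outChan_shift_nonneg hW (hQ q (htQ q hq)).1 hη.le)
    (fun x y => (Real.exp_pos (-s * (f x y - γ))).le) (fun x y => (Real.exp_pos (f x y - γ)).le)
    (expect_testErr_le_pow hp (fun x => (hW1 x).1)
      (fun x y1 => (Real.exp_pos (-s1 * (f1 x y1 - γ1))).le)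
      (fun x y1 => (Real.exp_pos (f1 x y1 - γ1)).le) hM0 _ zero_le_one hunit
      (htest1.1.trans hθ1θ') (htest1.2.trans hθ1θ'))
    (fun q hq => expect_testErr_le_pow hp
      (outChan_shift_nonneg hW (hQ q (htQ q hq)).1 hη.le)
      (fun x y => (Real.exp_pos (-s * (f x y - γ))).le)
      (fun x y => (Real.exp_pos (f x y - γ)).le) hM0 bin zero_le_two hmod
      ((htest q (htQ q hq)).1.trans hθθ') ((htest q (htQ q hq)).2.trans hθθ'))
  obtain ⟨C, hC⟩ := exists_code_errIID_le hW hV hfact hM0 bin c f f1 γ γ1 hs hs1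
  refine ⟨M, L, C, hM, hL, fun q hq => (hC q (hQ q hq)).trans ?_⟩
  obtain ⟨q', hq', hle⟩ := ht q hq
  refine le_trans (add_le_add le_rfl (testErr_mono
    (fun x => (isPMF_outChan hW (hQ q hq) x).1) (fun x y => ?_)
    (fun _ _ => (Real.exp_pos _).le) (fun _ _ => (Real.exp_pos _).le) bin c))
    ((hc q' hq').trans (le_of_eq (by ring)))
  exact Finset.sum_le_sum fun s _ => mul_le_mul_of_nonneg_right (hle s)
    (Finset.sum_nonneg fun y1 _ => (hW x s).1 _)

lemma compAchievable_of_lt [Nonempty 𝒳] (hW : IsChannel W) (hC1 : 0 ≤ C1)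
    (hQ : ∀ q ∈ Q, IsPMF q) (hQne : Q.Nonempty) (hQcomp : IsCompact Q) (hQconv : Convex ℝ Q)
    (hW1 : ∀ x, IsPMF (W1 x)) (hV : ∀ y1 s, IsPMF (V y1 s))
    (hfact : ∀ x s y y1, W x s (y, y1) = W1 x y1 * V y1 s y) (hp : IsPMF p) {v : ℝ}
    (hv : ∀ q ∈ Q, v ≤ chanInfo p (outChan W q)) (hrv : (R - C1) * Real.log 2 < v)
    (hr1 : R * Real.log 2 < chanInfo p W1) : CompAchievable W C1 Q R := by
  obtain ⟨D, θ, hθ0, hθ1, hcodes⟩ :=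
    exists_codes_of_lt hW hC1 hQ hQne hQcomp hQconv hW1 hV hfact hp hv hrv hr1
  intro ε hε
  have hlim : Filter.Tendsto (fun n : ℕ => D * θ ^ n) Filter.atTop (nhds 0) := by
    simpa using (tendsto_pow_atTop_nhds_zero_of_lt_one hθ0 hθ1).const_mul D
  obtain ⟨N, hN⟩ := Filter.eventually_atTop.1 (hlim.eventually_le_const hε)
  refine ⟨N, fun n hn => ?_⟩
  obtain ⟨M, L, C, hM, hL, hC⟩ := hcodes n
  exact ⟨M, L, C, hM, hL, fun q hq => (hC q hq).trans (hN n hn)⟩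

lemma CompCapacity_eq [Nonempty 𝒳] (hW : IsChannel W) (hC1 : 0 ≤ C1)
    (hQ : ∀ q ∈ Q, IsPMF q) (hQne : Q.Nonempty) (hQcomp : IsCompact Q) (hQconv : Convex ℝ Q)
    (hW1 : ∀ x, IsPMF (W1 x)) (hV : ∀ y1 s, IsPMF (V y1 s))
    (hfact : ∀ x s y y1, W x s (y, y1) = W1 x y1 * V y1 s y) :
    CompCapacity W C1 Q = sSup (rateSet W C1 Q W1) := by
  have hl2 : 0 < Real.log 2 := Real.log_pos one_lt_two
  have hub : ∀ R, CompAchievable W C1 Q R → R ≤ sSup (rateSet W C1 Q W1) := fun R hR =>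
    (hR.le_RCS hW hQ hQne).trans (RCS_eq hW hQ hQne hQcomp hQconv hW1 hV hfact).le
  have hach : ∀ R < sSup (rateSet W C1 Q W1), CompAchievable W C1 Q R := by
    intro R hR
    obtain ⟨_, ⟨p, hp, rfl⟩, hlt⟩ := exists_lt_of_lt_csSup (rateSet_nonempty W C1 Q W1) hR
    rw [lt_min_iff, mutInfo_eq_chanInfo p W1 fun x => (hW1 x).2, lt_div_iff₀ hl2,
      ← sub_lt_iff_lt_add] at hlt
    refine compAchievable_of_lt hW hC1 hQ hQne hQcomp hQconv hW1 hV hfact hp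
      (v := sInf {v | ∃ q ∈ Q, v = IqXY W p q} * Real.log 2) (fun q hq => ?_)
      (mul_lt_mul_of_pos_right hlt.1 hl2) hlt.2
    rw [← le_div_iff₀ hl2, ← IqXY_eq hW (hQ q hq)]
    exact csInf_le (bddBelow_IqXY W hQcomp p) ⟨q, hq, rfl⟩
  refine le_antisymm (csSup_le ⟨_, hach _ (sub_one_lt _)⟩ hub) ?_
  exact le_of_forall_lt_imp_le_of_dense fun R hR => le_csSup ⟨_, hub⟩ (hach R hR)

end CompoundCapacity

/-- For a strongly degraded compound primitive relay channel
(`W(y,y₁|x,s) = W₁(y₁|x)·V(y|y₁,s)`) with compact convex state set `Q`, the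
deterministic code capacity, `R_DF(Q)` and `R_CS(Q)` all coincide and equal
`max_{p(x)} min{ min_{q∈Q} I_q(X;Y) + C₁, I(X;Y₁) }`, where `I(X;Y₁)` is computed
under `p(x)` and the state-independent channel `W₁`. -/
theorem compound_stronglyDegraded_capacity
    {𝒳 𝒮 𝒴 𝒴₁ : Type} [Fintype 𝒳] [Fintype 𝒮] [Fintype 𝒴] [Fintype 𝒴₁] [Nonempty 𝒳]
    (W : 𝒳 → 𝒮 → 𝒴 × 𝒴₁ → ℝ) (hW : IsChannel W)
    (C1 : ℝ) (hC1 : 0 ≤ C1)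
    (Q : Set (𝒮 → ℝ)) (hQ : ∀ q ∈ Q, IsPMF q) (hQne : Q.Nonempty)
    (hQcomp : IsCompact Q) (hQconv : Convex ℝ Q)
    (W1 : 𝒳 → 𝒴₁ → ℝ) (V : 𝒴₁ → 𝒮 → 𝒴 → ℝ)
    (hW1 : ∀ x, IsPMF (W1 x)) (hV : ∀ y1 s, IsPMF (V y1 s))
    (hfact : ∀ x s y y1, W x s (y, y1) = W1 x y1 * V y1 s y) :
    CompCapacity W C1 Q
        = sSup {r | ∃ p : 𝒳 → ℝ, IsPMF p ∧
            r = min (sInf {v | ∃ q ∈ Q, v = IqXY W p q} + C1)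
                (mutInfo (fun xy1 : 𝒳 × 𝒴₁ => p xy1.1 * W1 xy1.1 xy1.2))} ∧
    RDF W C1 Q
        = sSup {r | ∃ p : 𝒳 → ℝ, IsPMF p ∧
            r = min (sInf {v | ∃ q ∈ Q, v = IqXY W p q} + C1)
                (mutInfo (fun xy1 : 𝒳 × 𝒴₁ => p xy1.1 * W1 xy1.1 xy1.2))} ∧
    RCS W C1 Q
        = sSup {r | ∃ p : 𝒳 → ℝ, IsPMF p ∧
            r = min (sInf {v | ∃ q ∈ Q, v = IqXY W p q} + C1)
                (mutInfo (fun xy1 : 𝒳 × 𝒴₁ => p xy1.1 * W1 xy1.1 xy1.2))} :=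
  ⟨CompCapacity_eq hW hC1 hQ hQne hQcomp hQconv hW1 hV hfact,
    RDF_eq hW hQ hQne hQcomp hW1 hV hfact,
    RCS_eq hW hQ hQne hQcomp hQconv hW1 hV hfact⟩
end
end

section
/- For a primitive AVRC, if C_1 > 0 and the deterministic code capacity of the marginal sender-to-relay AVC {W_{Y_1|X,S}} is positive, then the deterministic code capacity of the primitive AVRC coincides with its random code capacity: C(AVRC) = C*(AVRC). -/
open scoped BigOperators ENNReal

noncomputable section

/-- A deterministic code for a single-user arbitrarily varying channel. -/
structure ACode (𝒳 𝒴₁ : Type) (n M : ℕ) where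
  f : Fin M → Fin n → 𝒳
  g : (Fin n → 𝒴₁) → Fin M

/-- Conditional error probability of a single-user AVC code given state sequence `s`. -/
def ACode.errGiven {𝒳 𝒮 𝒴₁ : Type} [Fintype 𝒮] [Fintype 𝒴₁] {n M : ℕ}
    (C : ACode 𝒳 𝒴₁ n M) (V : 𝒳 → 𝒮 → 𝒴₁ → ℝ) (s : Fin n → 𝒮) : ℝ :=
  (M : ℝ)⁻¹ * ∑ m : Fin M, ∑ y1 : Fin n → 𝒴₁,
    if C.g y1 = m then 0 else ∏ i, V (C.f m i) (s i) (y1 i)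

/-- `R` is achievable by deterministic codes over the single-user AVC `V`. -/
def AVCAchievable {𝒳 𝒮 𝒴₁ : Type} [Fintype 𝒮] [Fintype 𝒴₁]
    (V : 𝒳 → 𝒮 → 𝒴₁ → ℝ) (R : ℝ) : Prop :=
  ∀ ε > (0 : ℝ), ∃ N : ℕ, ∀ n ≥ N, ∃ (M : ℕ) (C : ACode 𝒳 𝒴₁ n M),
    (2 : ℝ) ^ ((n : ℝ) * R) ≤ (M : ℝ) ∧
    ∀ qn : (Fin n → 𝒮) → ℝ, IsPMF qn →
      (∑ s : Fin n → 𝒮, qn s * C.errGiven V s) ≤ ε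

/-- The deterministic code capacity of the single-user AVC `V`. -/
def AVCCapacity {𝒳 𝒮 𝒴₁ : Type} [Fintype 𝒮] [Fintype 𝒴₁]
    (V : 𝒳 → 𝒮 → 𝒴₁ → ℝ) : ℝ :=
  sSup {R | AVCAchievable V R}

section ErrorTerms

variable {𝒳 𝒮 𝒴 𝒴₁ : Type} [Fintype 𝒴₁] {n M L : ℕ}

/-- Error probability of an AVC code for a fixed message and a fixed state sequence. -/
def ACode.msgErr (C : ACode 𝒳 𝒴₁ n M) (V : 𝒳 → 𝒮 → 𝒴₁ → ℝ) (m : Fin M)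
    (s : Fin n → 𝒮) : ℝ :=
  ∑ y1 : Fin n → 𝒴₁, if C.g y1 = m then 0 else ∏ i, V (C.f m i) (s i) (y1 i)

/-- Error probability of a relay code for a fixed message and a fixed state sequence. -/
def PCode.msgErr [Fintype 𝒴] (C : PCode 𝒳 𝒴 𝒴₁ n M L) (W : 𝒳 → 𝒮 → 𝒴 × 𝒴₁ → ℝ) (m : Fin M)
    (s : Fin n → 𝒮) : ℝ :=
  ∑ y : Fin n → 𝒴, ∑ y1 : Fin n → 𝒴₁,
    if C.g (y, C.f1 y1) = m then 0 else ∏ i, W (C.f m i) (s i) (y i, y1 i)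

lemma sum_prod_eq_one {𝒵 : Type} [Fintype 𝒵] {p : Fin n → 𝒵 → ℝ}
    (hp : ∀ i, ∑ z, p i z = 1) : ∑ z : Fin n → 𝒵, ∏ i, p i (z i) = 1 := by
  rw [← Fintype.prod_sum]
  simp [hp]

lemma sum_sum_prod_eq_prod {𝒴 𝒴₁ : Type} [Fintype 𝒴] (p : Fin n → 𝒴 × 𝒴₁ → ℝ) (y1 : Fin n → 𝒴₁) :
    ∑ y : Fin n → 𝒴, ∏ i, p i (y i, y1 i) = ∏ i, ∑ y, p i (y, y1 i) := by
  rw [Fintype.prod_sum (fun i y => p i (y, y1 i))]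

lemma sum_sum_prod_eq_one [Fintype 𝒴] {p : Fin n → 𝒴 × 𝒴₁ → ℝ} (hp : ∀ i, ∑ z, p i z = 1) :
    ∑ y : Fin n → 𝒴, ∑ y1 : Fin n → 𝒴₁, ∏ i, p i (y i, y1 i) = 1 := by
  rw [Finset.sum_comm]
  simp_rw [sum_sum_prod_eq_prod]
  apply sum_prod_eq_one (p := fun i z => ∑ y, p i (y, z))
  intro i
  rw [← hp i, Fintype.sum_prod_type_right]

lemma IsChannel.marginal [Fintype 𝒴] {W : 𝒳 → 𝒮 → 𝒴 × 𝒴₁ → ℝ} (hW : IsChannel W) :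
    IsChannel (fun x s y1 => ∑ y, W x s (y, y1)) := by
  intro x s
  refine ⟨fun y1 => Finset.sum_nonneg fun y _ => (hW x s).1 _, ?_⟩
  rw [← (hW x s).2, Fintype.sum_prod_type_right]

lemma ACode.msgErr_nonneg {V : 𝒳 → 𝒮 → 𝒴₁ → ℝ} (hV : IsChannel V) (C : ACode 𝒳 𝒴₁ n M)
    (m : Fin M) (s : Fin n → 𝒮) : 0 ≤ C.msgErr V m s := by
  refine Finset.sum_nonneg fun y1 _ => ?_
  split_ifs
  · exact le_rfl
  · exact Finset.prod_nonneg fun i _ => (hV _ _).1 _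

lemma ACode.msgErr_le_one {V : 𝒳 → 𝒮 → 𝒴₁ → ℝ} (hV : IsChannel V) (C : ACode 𝒳 𝒴₁ n M)
    (m : Fin M) (s : Fin n → 𝒮) : C.msgErr V m s ≤ 1 := by
  rw [← sum_prod_eq_one (p := fun i => V (C.f m i) (s i)) fun i => (hV _ _).2]
  refine Finset.sum_le_sum fun y1 _ => ?_
  split_ifs
  · exact Finset.prod_nonneg fun i _ => (hV _ _).1 _
  · exact le_rfl

lemma PCode.msgErr_nonneg [Fintype 𝒴] {W : 𝒳 → 𝒮 → 𝒴 × 𝒴₁ → ℝ} (hW : IsChannel W)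
    (C : PCode 𝒳 𝒴 𝒴₁ n M L) (m : Fin M) (s : Fin n → 𝒮) : 0 ≤ C.msgErr W m s := by
  refine Finset.sum_nonneg fun y _ => Finset.sum_nonneg fun y1 _ => ?_
  split_ifs
  · exact le_rfl
  · exact Finset.prod_nonneg fun i _ => (hW _ _).1 _

lemma PCode.msgErr_le_one [Fintype 𝒴] {W : 𝒳 → 𝒮 → 𝒴 × 𝒴₁ → ℝ} (hW : IsChannel W)
    (C : PCode 𝒳 𝒴 𝒴₁ n M L) (m : Fin M) (s : Fin n → 𝒮) : C.msgErr W m s ≤ 1 := by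
  rw [← sum_sum_prod_eq_one (p := fun i => W (C.f m i) (s i)) fun i => (hW _ _).2]
  refine Finset.sum_le_sum fun y _ => Finset.sum_le_sum fun y1 _ => ?_
  split_ifs
  · exact Finset.prod_nonneg fun i _ => (hW _ _).1 _
  · exact le_rfl

lemma PCode.errGiven_nonneg [Fintype 𝒮] [Fintype 𝒴] {W : 𝒳 → 𝒮 → 𝒴 × 𝒴₁ → ℝ} (hW : IsChannel W)
    (C : PCode 𝒳 𝒴 𝒴₁ n M L) (s : Fin n → 𝒮) : 0 ≤ C.errGiven W s :=
  mul_nonneg (by positivity) (Finset.sum_nonneg fun m _ => C.msgErr_nonneg hW m s)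

lemma PCode.errGiven_le_one [Fintype 𝒮] [Fintype 𝒴] {W : 𝒳 → 𝒮 → 𝒴 × 𝒴₁ → ℝ} (hW : IsChannel W)
    (C : PCode 𝒳 𝒴 𝒴₁ n M L) (s : Fin n → 𝒮) : C.errGiven W s ≤ 1 := by
  have h : ∑ m, C.msgErr W m s ≤ M := by
    simpa using Finset.sum_le_card_nsmul Finset.univ (fun m => C.msgErr W m s) 1
      fun m _ => C.msgErr_le_one hW m s
  calc C.errGiven W s ≤ (M : ℝ)⁻¹ * M := mul_le_mul_of_nonneg_left h (by positivity)
    _ ≤ 1 := inv_mul_le_one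

end ErrorTerms

section Prefixing

variable {𝒳 𝒮 𝒴 𝒴₁ : Type} [Fintype 𝒴] [Fintype 𝒴₁] {ν n M M' K L : ℕ}

/-- The relay code which announces, by a prefix code to the relay, which code of a finite
family is used in the remaining block; the relay forwards this index over the link. -/
def PCode.prefixed (P : ACode 𝒳 𝒴₁ ν M') (ι : Fin K → Fin M') (κ : Fin M' → Fin K)
    (C : Fin K → PCode 𝒳 𝒴 𝒴₁ n M L) : PCode 𝒳 𝒴 𝒴₁ (ν + n) (K * M) (K * L) where
  f w := Fin.append (P.f (ι (finProdFinEquiv.symm w).1))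
    ((C (finProdFinEquiv.symm w).1).f (finProdFinEquiv.symm w).2)
  f1 y1 := finProdFinEquiv (κ (P.g fun i => y1 (Fin.castAdd n i)),
    (C (κ (P.g fun i => y1 (Fin.castAdd n i)))).f1 fun i => y1 (Fin.natAdd ν i))
  g p := finProdFinEquiv ((finProdFinEquiv.symm p.2).1,
    (C (finProdFinEquiv.symm p.2).1).g
      (fun i => p.1 (Fin.natAdd ν i), (finProdFinEquiv.symm p.2).2))

lemma sum_append {α : Type} [Fintype α] (F : (Fin (ν + n) → α) → ℝ) :
    ∑ z, F z = ∑ p : (Fin ν → α) × (Fin n → α), F (Fin.append p.1 p.2) :=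
  (Equiv.sum_comp (Fin.appendEquiv ν n) F).symm

lemma sum_prod_sum_prod_mul {α β γ δ : Type} [Fintype α] [Fintype β] [Fintype γ] [Fintype δ]
    (F : α → γ → ℝ) (G : β → δ → ℝ) :
    ∑ p : α × β, ∑ q : γ × δ, F p.1 q.1 * G p.2 q.2
      = (∑ a, ∑ c, F a c) * ∑ b, ∑ d, G b d := by
  simp only [Fintype.sum_prod_type, ← Finset.mul_sum, ← Finset.sum_mul]

lemma PCode.msgErr_prefixed_le {W : 𝒳 → 𝒮 → 𝒴 × 𝒴₁ → ℝ} (hW : IsChannel W)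
    (P : ACode 𝒳 𝒴₁ ν M') (ι : Fin K → Fin M') (κ : Fin M' → Fin K)
    (hκ : ∀ k, κ (ι k) = k) (C : Fin K → PCode 𝒳 𝒴 𝒴₁ n M L) (k : Fin K) (m : Fin M)
    (s : Fin (ν + n) → 𝒮) :
    (PCode.prefixed P ι κ C).msgErr W (finProdFinEquiv (k, m)) s
      ≤ P.msgErr (fun x s y1 => ∑ y, W x s (y, y1)) (ι k) (fun i => s (Fin.castAdd n i))
        + (C k).msgErr W m (fun i => s (Fin.natAdd ν i)) := by
  set s₁ : Fin ν → 𝒮 := fun i => s (Fin.castAdd n i)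
  set s₂ : Fin n → 𝒮 := fun i => s (Fin.natAdd ν i)
  let A : (Fin ν → 𝒴) → (Fin ν → 𝒴₁) → ℝ := fun a a1 =>
    ∏ i, W (P.f (ι k) i) (s₁ i) (a i, a1 i)
  let B : (Fin n → 𝒴) → (Fin n → 𝒴₁) → ℝ := fun b b1 =>
    ∏ i, W ((C k).f m i) (s₂ i) (b i, b1 i)
  have hA : ∀ a a1, 0 ≤ A a a1 := fun a a1 => Finset.prod_nonneg fun i _ => (hW _ _).1 _
  have hB : ∀ b b1, 0 ≤ B b b1 := fun b b1 => Finset.prod_nonneg fun i _ => (hW _ _).1 _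
  have hA1 : ∑ a, ∑ a1, A a a1 = 1 :=
    sum_sum_prod_eq_one (p := fun i => W (P.f (ι k) i) (s₁ i)) fun i => (hW _ _).2
  have hB1 : ∑ b, ∑ b1, B b b1 = 1 :=
    sum_sum_prod_eq_one (p := fun i => W ((C k).f m i) (s₂ i)) fun i => (hW _ _).2
  let A' : (Fin ν → 𝒴) → (Fin ν → 𝒴₁) → ℝ := fun a a1 => if P.g a1 = ι k then 0 else A a a1
  let B' : (Fin n → 𝒴) → (Fin n → 𝒴₁) → ℝ := fun b b1 =>
    if (C k).g (b, (C k).f1 b1) = m then 0 else B b b1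
  have hA' : ∑ a, ∑ a1, A' a a1 = P.msgErr (fun x s y1 => ∑ y, W x s (y, y1)) (ι k) s₁ := by
    rw [Finset.sum_comm]
    refine Finset.sum_congr rfl fun a1 _ => ?_
    by_cases h : P.g a1 = ι k
    · simp [A', h]
    · simpa [A', A, h] using
        sum_sum_prod_eq_prod (fun i => W (P.f (ι k) i) (s₁ i)) a1
  have hprod : ∀ (p : (Fin ν → 𝒴) × (Fin n → 𝒴)) (q : (Fin ν → 𝒴₁) × (Fin n → 𝒴₁)),
      ∏ i, W ((PCode.prefixed P ι κ C).f (finProdFinEquiv (k, m)) i) (s i)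
        (Fin.append p.1 p.2 i, Fin.append q.1 q.2 i) = A p.1 q.1 * B p.2 q.2 := by
    intro p q
    rw [Fin.prod_univ_add]
    simp [PCode.prefixed, A, B, s₁, s₂, -finProdFinEquiv_symm_apply]
  calc (PCode.prefixed P ι κ C).msgErr W (finProdFinEquiv (k, m)) s
      ≤ ∑ p : (Fin ν → 𝒴) × (Fin n → 𝒴), ∑ q : (Fin ν → 𝒴₁) × (Fin n → 𝒴₁),
          (A' p.1 q.1 * B p.2 q.2 + A p.1 q.1 * B' p.2 q.2) := by
        unfold PCode.msgErr
        rw [sum_append]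
        refine Finset.sum_le_sum fun p _ => ?_
        rw [sum_append]
        refine Finset.sum_le_sum fun q _ => ?_
        rw [hprod]
        have h0 := mul_nonneg (hA p.1 q.1) (hB p.2 q.2)
        by_cases h1 : P.g q.1 = ι k
        · by_cases h2 : (C k).g (p.2, (C k).f1 q.2) = m
          · simp [PCode.prefixed, A', B', h1, h2, hκ, -finProdFinEquiv_symm_apply]
          · simp only [A', B', h1, h2, if_true, if_false]
            split_ifs <;> simp [h0]
        · have h3 : 0 ≤ A p.1 q.1 * B' p.2 q.2 := by
            refine mul_nonneg (hA _ _) ?_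
            simp only [B']
            split_ifs
            exacts [le_rfl, hB _ _]
          simp only [A', h1, if_false]
          split_ifs
          · linarith
          · linarith
    _ = _ := by
        simp_rw [Finset.sum_add_distrib]
        rw [sum_prod_sum_prod_mul A' B, sum_prod_sum_prod_mul A B', hA', hA1, hB1, mul_one,
          one_mul]
        rfl

lemma PCode.errGiven_prefixed_le [Fintype 𝒮] {W : 𝒳 → 𝒮 → 𝒴 × 𝒴₁ → ℝ} (hW : IsChannel W) (hM : 0 < M)
    (P : ACode 𝒳 𝒴₁ ν M') (ι : Fin K → Fin M') (κ : Fin M' → Fin K)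
    (hκ : ∀ k, κ (ι k) = k) (C : Fin K → PCode 𝒳 𝒴 𝒴₁ n M L) (s : Fin (ν + n) → 𝒮) :
    (PCode.prefixed P ι κ C).errGiven W s
      ≤ (K : ℝ)⁻¹ * (∑ k, P.msgErr (fun x s y1 => ∑ y, W x s (y, y1)) (ι k)
            (fun i => s (Fin.castAdd n i))
          + ∑ k, (C k).errGiven W (fun i => s (Fin.natAdd ν i))) := by
  have hM' : (M : ℝ) ≠ 0 := by positivity
  have h1 : (PCode.prefixed P ι κ C).errGiven W s = ((K * M : ℕ) : ℝ)⁻¹ *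
      ∑ p : Fin K × Fin M, (PCode.prefixed P ι κ C).msgErr W (finProdFinEquiv p) s := by
    rw [Equiv.sum_comp finProdFinEquiv fun w => (PCode.prefixed P ι κ C).msgErr W w s]
    rfl
  have h2 : ∀ k, (C k).errGiven W (fun i => s (Fin.natAdd ν i))
      = (M : ℝ)⁻¹ * ∑ m, (C k).msgErr W m (fun i => s (Fin.natAdd ν i)) := fun _ => rfl
  rw [h1]
  calc _ ≤ ((K * M : ℕ) : ℝ)⁻¹ * ∑ p : Fin K × Fin M,
        (P.msgErr (fun x s y1 => ∑ y, W x s (y, y1)) (ι p.1) (fun i => s (Fin.castAdd n i))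
          + (C p.1).msgErr W p.2 (fun i => s (Fin.natAdd ν i))) := by
        gcongr with p
        exact PCode.msgErr_prefixed_le hW P ι κ hκ C p.1 p.2 s
    _ = _ := by
        simp_rw [h2, ← Finset.mul_sum, Fintype.sum_prod_type, Finset.sum_add_distrib]
        simp only [Finset.sum_const, Finset.card_univ, Fintype.card_fin, nsmul_eq_mul,
          ← Finset.mul_sum]
        push_cast
        field_simp

end Prefixing

/-- Derandomization by the method of conditional expectations: if for every weight on the
states some new action has small average cost, then some `K` distinct actions have small
total cost for every state simultaneously. -/
lemma exists_injective_sum_le {σ α : Type} [Fintype σ] (c : α → σ → ℝ)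
    (hc0 : ∀ a s, 0 ≤ c a s) (hc1 : ∀ a s, c a s ≤ 1) {δ : ℝ} {K : ℕ}
    (h : ∀ F : Finset α, F.card < K → ∀ u : σ → ℝ, (∀ s, 0 ≤ u s) →
      ∃ a ∉ F, ∑ s, u s * c a s ≤ δ * ∑ s, u s) :
    ∃ ι : Fin K → α, Function.Injective ι ∧
      ∀ s, ∑ k, c (ι k) s ≤ Real.log (Fintype.card σ) + 2 * δ * K := by
  classical
  have key : ∀ k ≤ K, ∃ F : Finset α, F.card = k ∧
      ∑ s, Real.exp (∑ a ∈ F, c a s) ≤ Fintype.card σ * Real.exp (2 * δ * k) := by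
    intro k
    induction k with
    | zero => exact fun _ => ⟨∅, by simp⟩
    | succ k ih =>
      intro hk
      obtain ⟨F, hF, hle⟩ := ih (by omega)
      obtain ⟨a, ha, hav⟩ := h F (by omega) (fun s => Real.exp (∑ a ∈ F, c a s))
        fun s => (Real.exp_pos _).le
      refine ⟨insert a F, by rw [Finset.card_insert_of_notMem ha, hF], ?_⟩
      have hexp : ∀ s, Real.exp (c a s) ≤ 1 + 2 * c a s := by
        intro s
        have h0 := hc0 a s
        have h1 := hc1 a s
        have := Real.abs_exp_sub_one_le (x := c a s) (by rw [abs_of_nonneg h0]; exact h1)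
        rw [abs_of_nonneg h0] at this
        linarith [le_abs_self (Real.exp (c a s) - 1)]
      have hu : 0 ≤ ∑ s, Real.exp (∑ a ∈ F, c a s) :=
        Finset.sum_nonneg fun s _ => (Real.exp_pos _).le
      calc ∑ s, Real.exp (∑ b ∈ insert a F, c b s)
          ≤ ∑ s, (Real.exp (∑ b ∈ F, c b s) + 2 * (Real.exp (∑ b ∈ F, c b s) * c a s)) := by
            refine Finset.sum_le_sum fun s _ => ?_
            rw [Finset.sum_insert ha, Real.exp_add]
            nlinarith [hexp s, Real.exp_pos (∑ b ∈ F, c b s)]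
        _ ≤ (2 * δ + 1) * ∑ s, Real.exp (∑ b ∈ F, c b s) := by
            rw [Finset.sum_add_distrib, ← Finset.mul_sum]
            linarith
        _ ≤ Real.exp (2 * δ) * (Fintype.card σ * Real.exp (2 * δ * k)) :=
            mul_le_mul (Real.add_one_le_exp _) hle hu (Real.exp_pos _).le
        _ = _ := by
            push_cast
            rw [mul_add, mul_one, Real.exp_add]
            ring
  obtain ⟨F, hF, hle⟩ := key K le_rfl
  let e : Fin K ≃ F := (Finset.equivFinOfCardEq hF).symm
  refine ⟨fun k => (e k : α), Subtype.val_injective.comp e.injective, fun s => ?_⟩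
  have hs : ∑ k, c (e k : α) s = ∑ a ∈ F, c a s := by
    rw [Equiv.sum_comp e fun a : F => c (a : α) s, Finset.sum_coe_sort F fun a => c a s]
  have hcard : (0 : ℝ) < Fintype.card σ := by
    exact_mod_cast Fintype.card_pos_iff.2 ⟨s⟩
  rw [hs, ← Real.exp_le_exp, Real.exp_add, Real.exp_log hcard]
  exact (Finset.single_le_sum (f := fun s => Real.exp (∑ a ∈ F, c a s))
    (fun s _ => (Real.exp_pos _).le) (Finset.mem_univ s)).trans hle

section Derandomization

variable {𝒳 𝒮 𝒴 𝒴₁ : Type} [Fintype 𝒮] [Fintype 𝒴] [Fintype 𝒴₁] {n M L : ℕ}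

lemma exists_subcode {V : 𝒳 → 𝒮 → 𝒴₁ → ℝ} (hV : IsChannel V) (C : ACode 𝒳 𝒴₁ n M)
    {ε : ℝ} (hC : ∀ s, C.errGiven V s ≤ ε) {K : ℕ} (hK : 0 < K) (hKM : 2 * K ≤ M) :
    ∃ ι : Fin K → Fin M, Function.Injective ι ∧
      ∀ s, ∑ k, C.msgErr V (ι k) s ≤ n * Real.log (Fintype.card 𝒮) + 4 * ε * K := by
  have hM : (0 : ℝ) < M := by exact_mod_cast (show 0 < M by omega)
  have hsum : ∀ s, ∑ m, C.msgErr V m s ≤ M * ε := by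
    intro s
    have := hC s
    change (M : ℝ)⁻¹ * ∑ m, C.msgErr V m s ≤ ε at this
    rwa [inv_mul_le_iff₀ hM] at this
  obtain ⟨ι, hι, hle⟩ := exists_injective_sum_le (K := K) (δ := 2 * ε) (C.msgErr V)
    (C.msgErr_nonneg hV) (C.msgErr_le_one hV) (by
      intro F hF u hu
      by_contra! hcon
      have hcard : (M : ℝ) ≤ 2 * (Fᶜ.card : ℝ) := by
        have h1 := F.card_compl_add_card
        rw [Fintype.card_fin] at h1
        exact_mod_cast (show M ≤ 2 * Fᶜ.card by omega)
      have hne : Fᶜ.Nonempty := by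
        rw [← Finset.card_pos]
        have : (0 : ℝ) < Fᶜ.card := by linarith
        exact_mod_cast this
      have hU : 0 ≤ ∑ s, u s := Finset.sum_nonneg fun s _ => hu s
      have hup : ∑ m ∈ Fᶜ, ∑ s, u s * C.msgErr V m s ≤ M * ε * ∑ s, u s := by
        calc ∑ m ∈ Fᶜ, ∑ s, u s * C.msgErr V m s
            ≤ ∑ m, ∑ s, u s * C.msgErr V m s :=
              Finset.sum_le_sum_of_subset_of_nonneg (Finset.subset_univ _) fun m _ _ =>
                Finset.sum_nonneg fun s _ => mul_nonneg (hu s) (C.msgErr_nonneg hV m s)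
          _ = ∑ s, u s * ∑ m, C.msgErr V m s := by
              rw [Finset.sum_comm]
              simp_rw [Finset.mul_sum]
          _ ≤ ∑ s, u s * (M * ε) :=
              Finset.sum_le_sum fun s _ => mul_le_mul_of_nonneg_left (hsum s) (hu s)
          _ = _ := by rw [← Finset.sum_mul, mul_comm]
      have hlow : ∑ m ∈ Fᶜ, 2 * ε * ∑ s, u s < ∑ m ∈ Fᶜ, ∑ s, u s * C.msgErr V m s :=
        Finset.sum_lt_sum_of_nonempty hne fun m hm => hcon m (Finset.mem_compl.1 hm)
      rw [Finset.sum_const, nsmul_eq_mul] at hlow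
      by_cases hs : Nonempty (Fin n → 𝒮)
      · obtain ⟨s⟩ := hs
        have hε : 0 ≤ ε := by
          have : 0 ≤ (M : ℝ) * ε := (Finset.sum_nonneg fun m _ =>
            C.msgErr_nonneg hV m s).trans (hsum s)
          exact nonneg_of_mul_nonneg_right this hM
        nlinarith [mul_nonneg hε hU]
      · rw [not_nonempty_iff] at hs
        simp at hlow)
  refine ⟨ι, hι, fun s => (hle s).trans (le_of_eq ?_)⟩
  rw [Fintype.card_fun, Fintype.card_fin]
  push_cast
  rw [Real.log_pow]
  ring

lemma exists_code_family {W : 𝒳 → 𝒮 → 𝒴 × 𝒴₁ → ℝ} (hW : IsChannel W) {ε : ℝ} (hε : 0 < ε)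
    {J : Type} (π : PMF J) (Cs : J → PCode 𝒳 𝒴 𝒴₁ n M L)
    (hCs : ∀ qn : (Fin n → 𝒮) → ℝ, IsPMF qn →
      (∑' j, π j * ENNReal.ofReal ((Cs j).errJoint W qn)) ≤ ENNReal.ofReal ε) (K : ℕ) :
    ∃ C : Fin K → PCode 𝒳 𝒴 𝒴₁ n M L,
      ∀ s, ∑ k, (C k).errGiven W s ≤ n * Real.log (Fintype.card 𝒮) + 4 * ε * K := by
  have hJ : Nonempty J := by
    obtain ⟨j, -⟩ := π.support_nonempty
    exact ⟨j⟩
  have hpick : ∀ u : (Fin n → 𝒮) → ℝ, (∀ s, 0 ≤ u s) →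
      ∃ j, ∑ s, u s * (Cs j).errGiven W s ≤ 2 * ε * ∑ s, u s := by
    intro u hu
    have hU : 0 ≤ ∑ s, u s := Finset.sum_nonneg fun s _ => hu s
    rcases hU.eq_or_lt with h0 | hpos
    · refine ⟨hJ.some, ?_⟩
      have hz : ∀ s, u s = 0 := fun s =>
        (Finset.sum_eq_zero_iff_of_nonneg fun s _ => hu s).1 h0.symm s (Finset.mem_univ s)
      simp [hz]
    · have hq : IsPMF fun s => (∑ s, u s)⁻¹ * u s :=
        ⟨fun s => mul_nonneg (by positivity) (hu s), by
          rw [← Finset.mul_sum, inv_mul_cancel₀ hpos.ne']⟩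
      have hle := hCs _ hq
      by_contra! hcon
      have hlow : ENNReal.ofReal (2 * ε) ≤
          ∑' j, π j * ENNReal.ofReal ((Cs j).errJoint W fun s => (∑ s, u s)⁻¹ * u s) := by
        calc ENNReal.ofReal (2 * ε) = ∑' j, π j * ENNReal.ofReal (2 * ε) := by
              rw [ENNReal.tsum_mul_right, π.tsum_coe, one_mul]
          _ ≤ _ := by
              refine ENNReal.tsum_le_tsum fun j => ?_
              gcongr
              unfold PCode.errJoint
              simp_rw [mul_assoc, ← Finset.mul_sum]
              rw [le_inv_mul_iff₀ hpos, mul_comm]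
              exact (hcon j).le
      have := (ENNReal.ofReal_le_ofReal_iff hε.le).1 (hlow.trans hle)
      linarith
  obtain ⟨ι, -, hle⟩ := exists_injective_sum_le (K := K) (δ := 2 * ε)
    (fun a : J × ℕ => (Cs a.1).errGiven W) (fun a => (Cs a.1).errGiven_nonneg hW)
    (fun a => (Cs a.1).errGiven_le_one hW) (by
      intro F _ u hu
      obtain ⟨j, hj⟩ := hpick u hu
      classical
      obtain ⟨t, ht⟩ := Infinite.exists_notMem_finset (F.image Prod.snd)
      exact ⟨(j, t), fun hmem => ht (Finset.mem_image_of_mem Prod.snd hmem), hj⟩)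
  refine ⟨fun k => Cs (ι k).1, fun s => (hle s).trans (le_of_eq ?_)⟩
  rw [Fintype.card_fun, Fintype.card_fin]
  push_cast
  rw [Real.log_pow]
  ring

end Derandomization

lemma exists_forall_linear_le_two_rpow (b c : ℝ) {a : ℝ} (ha : 0 < a) :
    ∃ N : ℕ, ∀ n ≥ N, b * (n : ℝ) + c ≤ (2 : ℝ) ^ ((n : ℝ) * a) := by
  have hr : 1 < (2 : ℝ) ^ a := Real.one_lt_rpow (by norm_num) ha
  have h := ((tendsto_pow_const_div_const_pow_of_one_lt 1 hr).const_mul b).add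
    ((tendsto_pow_const_div_const_pow_of_one_lt 0 hr).const_mul c)
  simp only [mul_zero, add_zero] at h
  obtain ⟨N, hN⟩ := Filter.eventually_atTop.1 (h.eventually_le_const one_pos)
  refine ⟨N, fun n hn => ?_⟩
  have h1 := hN n hn
  have hpos : 0 < ((2 : ℝ) ^ a) ^ n := by positivity
  rw [mul_comm (n : ℝ) a, Real.rpow_mul (by norm_num), Real.rpow_natCast]
  rw [pow_one, pow_zero, ← mul_div_assoc, ← mul_div_assoc, ← add_div, div_le_one hpos] at h1
  linarith

section Achievability

variable {𝒳 𝒮 𝒴 𝒴₁ : Type} [Fintype 𝒮] [Fintype 𝒴] [Fintype 𝒴₁]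

lemma AVRCAchievable.randAchievable {W : 𝒳 → 𝒮 → 𝒴 × 𝒴₁ → ℝ} {C1 R : ℝ}
    (h : AVRCAchievable W C1 R) : AVRCRandAchievable W C1 R := by
  intro ε hε
  obtain ⟨N, hN⟩ := h ε hε
  refine ⟨N, fun n hn => ?_⟩
  obtain ⟨M, L, C, hM, hL, hC⟩ := hN n hn
  refine ⟨M, L, hM, hL, Unit, PMF.pure (), fun _ => C, fun qn hq => ?_⟩
  simpa using ENNReal.ofReal_le_ofReal (hC qn hq)

lemma AVRCRandAchievable.achievable_sub {W : 𝒳 → 𝒮 → 𝒴 × 𝒴₁ → ℝ} (hW : IsChannel W)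
    {C1 R R' δ : ℝ} (hC1 : 0 < C1) (hR' : 0 < R')
    (hmarg : AVCAchievable (fun x s y1 => ∑ y, W x s (y, y1)) R')
    (h : AVRCRandAchievable W C1 R) (hδ : 0 < δ) : AVRCAchievable W C1 (R - δ) := by
  intro ε₀ hε₀
  obtain ⟨ε, hε, hεε⟩ : ∃ ε : ℝ, 0 < ε ∧ 10 * ε = ε₀ := ⟨ε₀ / 10, by positivity, by ring⟩
  obtain ⟨N₁, hN₁⟩ := h ε hε
  obtain ⟨N₂, hN₂⟩ := hmarg ε hε
  obtain ⟨t, ht2, htR⟩ : ∃ t : ℕ, 2 ≤ t ∧ R ≤ t * δ := by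
    refine ⟨max 2 ⌈R / δ⌉₊, le_max_left _ _, ?_⟩
    rw [← div_le_iff₀ hδ]
    exact (Nat.le_ceil _).trans (by exact_mod_cast le_max_right _ _)
  set ℓ : ℝ := Real.log (Fintype.card 𝒮)
  have hℓ : 0 ≤ ℓ := Real.log_natCast_nonneg _
  obtain ⟨N₃, hN₃⟩ := exists_forall_linear_le_two_rpow (2 * (t * (ℓ / ε)))
    (2 * (t * (ℓ / ε) + 2)) (lt_min hR' hC1)
  refine ⟨t * (N₁ + N₂ + N₃), fun N hN => ?_⟩
  obtain ⟨ν, n, rfl, hνN, hnν, htν, hNt⟩ : ∃ ν n : ℕ, N = ν + n ∧ N₁ + N₂ + N₃ ≤ ν ∧ ν ≤ n ∧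
      t * ν ≤ N ∧ N ≤ t * (ν + 1) := by
    have h1 : t * (N / t) ≤ N := Nat.mul_div_le N t
    have h2 : 2 * (N / t) ≤ t * (N / t) := Nat.mul_le_mul_right _ ht2
    refine ⟨N / t, N - N / t, by omega, ?_, by omega, h1, ?_⟩
    · rw [Nat.le_div_iff_mul_le (by omega), mul_comm]
      exact hN
    · exact (Nat.lt_mul_div_succ N (by omega)).le
  obtain ⟨M, L, hM, hL, J, π, Cs, hCs⟩ := hN₁ n (by omega)
  obtain ⟨M', P, hM', hP⟩ := hN₂ ν (by omega)
  have hexp := hN₃ ν (by omega)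
  set K : ℕ := ⌈((ν + n : ℕ) : ℝ) * (ℓ / ε)⌉₊ + 1 with hKdef
  have hKpos : 0 < K := Nat.succ_pos _
  have hKpos' : (0 : ℝ) < K := by exact_mod_cast hKpos
  have hKlow : ((ν + n : ℕ) : ℝ) * ℓ ≤ ε * K := by
    have h1 := Nat.le_ceil (((ν + n : ℕ) : ℝ) * (ℓ / ε))
    have h2 : ((ν + n : ℕ) : ℝ) * (ℓ / ε) ≤ K := by
      rw [hKdef]; push_cast at h1 ⊢; linarith
    calc ((ν + n : ℕ) : ℝ) * ℓ = ε * (((ν + n : ℕ) : ℝ) * (ℓ / ε)) := by field_simp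
      _ ≤ ε * K := mul_le_mul_of_nonneg_left h2 hε.le
  have hKup : 2 * (K : ℝ) ≤ (2 : ℝ) ^ ((ν : ℝ) * min R' C1) := by
    refine le_trans ?_ hexp
    have h1 := Nat.ceil_lt_add_one (a := ((ν + n : ℕ) : ℝ) * (ℓ / ε)) (by positivity)
    have h2 : ((ν + n : ℕ) : ℝ) * (ℓ / ε) ≤ (t * (ν + 1)) * (ℓ / ε) := by
      gcongr
      exact_mod_cast hNt
    have h3 : (K : ℝ) = (⌈((ν + n : ℕ) : ℝ) * (ℓ / ε)⌉₊ : ℝ) + 1 := by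
      rw [hKdef]; push_cast; rfl
    rw [h3]
    linarith
  have hKM' : 2 * K ≤ M' := by
    have : 2 * (K : ℝ) ≤ M' := hKup.trans ((Real.rpow_le_rpow_of_exponent_le one_le_two
      (mul_le_mul_of_nonneg_left (min_le_left _ _) (Nat.cast_nonneg ν))).trans hM')
    exact_mod_cast this
  have hKC1 : (K : ℝ) ≤ (2 : ℝ) ^ ((ν : ℝ) * C1) := by
    have := hKup.trans (Real.rpow_le_rpow_of_exponent_le one_le_two
      (mul_le_mul_of_nonneg_left (min_le_right R' C1) (Nat.cast_nonneg ν)))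
    linarith
  have hPs : ∀ s, P.errGiven (fun x s y1 => ∑ y, W x s (y, y1)) s ≤ ε := by
    intro s
    classical
    have := hP (Pi.single s 1) ⟨fun a => by
      by_cases ha : a = s <;> simp [ha], by simp⟩
    simpa [Pi.single_apply] using this
  have hMpos : 0 < M := by
    have : (0 : ℝ) < M := (by positivity : (0 : ℝ) < 2 ^ ((n : ℝ) * R)).trans_le hM
    exact_mod_cast this
  obtain ⟨ι, hι, hιle⟩ := exists_subcode hW.marginal P hPs hKpos hKM'
  obtain ⟨C, hC⟩ := exists_code_family hW hε π Cs hCs K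
  have : Nonempty (Fin K) := ⟨⟨0, hKpos⟩⟩
  refine ⟨K * M, K * L, PCode.prefixed P ι (Function.invFun ι) C, ?_, ⟨?_, ?_⟩, ?_⟩
  · calc (2 : ℝ) ^ (((ν + n : ℕ) : ℝ) * (R - δ)) ≤ (2 : ℝ) ^ ((n : ℝ) * R) := by
          refine Real.rpow_le_rpow_of_exponent_le one_le_two ?_
          have h1 : (ν : ℝ) * R ≤ ν * (t * δ) := mul_le_mul_of_nonneg_left htR (by positivity)
          have h2 : (t : ℝ) * ν * δ ≤ ((ν + n : ℕ) : ℝ) * δ := by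
            gcongr
            exact_mod_cast htν
          push_cast at h2 ⊢
          linarith
      _ ≤ M := hM
      _ ≤ ((K * M : ℕ) : ℝ) := by exact_mod_cast Nat.le_mul_of_pos_left M hKpos
  · exact Nat.mul_pos hKpos hL.1
  · push_cast
    rw [add_mul, Real.rpow_add two_pos]
    exact mul_le_mul hKC1 hL.2 (by positivity) (by positivity)
  · intro qn hq
    have hs : ∀ s, (PCode.prefixed P ι (Function.invFun ι) C).errGiven W s ≤ ε₀ := by
      intro s
      refine (PCode.errGiven_prefixed_le hW hMpos P ι _ (Function.leftInverse_invFun hι) C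
        s).trans ?_
      rw [inv_mul_le_iff₀ hKpos', ← hεε]
      have h1 := hιle fun i => s (Fin.castAdd n i)
      have h2 := hC fun i => s (Fin.natAdd ν i)
      push_cast at hKlow
      have h3 : 0 ≤ ε * K := by positivity
      linarith
    calc PCode.errJoint _ W qn ≤ ∑ s, qn s * ε₀ :=
          Finset.sum_le_sum fun s _ => mul_le_mul_of_nonneg_left (hs s) (hq.1 s)
      _ = ε₀ := by rw [← Finset.sum_mul, hq.2, one_mul]

end Achievability

lemma csSup_eq_of_subset_of_forall_sub_mem {A B : Set ℝ} (hAB : A ⊆ B)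
    (hBA : ∀ R ∈ B, ∀ δ > 0, R - δ ∈ A) : sSup A = sSup B := by
  rcases B.eq_empty_or_nonempty with rfl | ⟨R₀, hR₀⟩
  · rw [Set.subset_empty_iff.1 hAB]
  have hne : A.Nonempty := ⟨R₀ - 1, hBA R₀ hR₀ 1 one_pos⟩
  have hub : upperBounds A = upperBounds B :=
    Set.Subset.antisymm
      (fun b hb R hR => le_of_forall_sub_le fun δ hδ => hb (hBA R hR δ hδ))
      (upperBounds_mono_set hAB)
  by_cases hA : BddAbove A
  · refine IsLUB.unique (isLUB_csSup hne hA) ?_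
    rw [IsLUB, hub]
    exact isLUB_csSup ⟨R₀, hR₀⟩ (by rwa [BddAbove, ← hub])
  · rw [Real.sSup_of_not_bddAbove hA,
      Real.sSup_of_not_bddAbove (by rwa [BddAbove, ← hub])]

/-- If `C₁ > 0` and the deterministic code capacity of the marginal sender-to-relay
AVC `{W_{Y₁|X,S}}` is positive, then the deterministic and random code capacities of
the primitive AVRC coincide. -/
theorem avrc_detCapacity_eq_randomCapacity_of_posMarginal
    {𝒳 𝒮 𝒴 𝒴₁ : Type} [Fintype 𝒳] [Fintype 𝒮] [Fintype 𝒴] [Fintype 𝒴₁] [Nonempty 𝒳]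
    (W : 𝒳 → 𝒮 → 𝒴 × 𝒴₁ → ℝ) (hW : IsChannel W)
    (C1 : ℝ) (hC1 : 0 < C1)
    (hmarg : 0 < AVCCapacity (fun x s y1 => ∑ y, W x s (y, y1))) :
    AVRCCapacity W C1 = AVRCRandCapacity W C1 := by
  obtain ⟨R', hR', hpos⟩ : ∃ R', AVCAchievable (fun x s y1 => ∑ y, W x s (y, y1)) R' ∧
      0 < R' := by
    by_contra! hcon
    exact hmarg.not_ge (Real.sSup_nonpos hcon)
  exact csSup_eq_of_subset_of_forall_sub_mem (fun R hR => hR.randAchievable)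
    fun R hR δ hδ => hR.achievable_sub hW hC1 hpos hR' hδ
end
end
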